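/- Let g be the Kac-Moody algebra of an indecomposable symmetrizable generalized Cartan matrix A, let (I,J) be a C-admissible pair, g^J the associated C-admissible subalgebra, and Δ^J the root system of the pair (g^J, h^J). Then g is finitely Δ^J-graded with grading subalgebra g^J: g decomposes as the sum of the weight spaces V_γ = {x∈g : [h,x] = ⟨γ,h⟩x for all h∈h^J} over γ ∈ Δ^J∪{0}, each V_γ is finite dimensional, and the set of nonzero weights of ad(h^J) on g is exactly Δ^J. -/

import Mathlib

attribute [local instance] Classical.propDecidable

noncomputable section

namespace KMG

open Module

/-! ### Generalized Cartan matrices -/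

/-- `A` is a generalized Cartan matrix. -/
def IsGCM {I : Type*} (A : Matrix I I ℤ) : Prop :=
  (∀ i, A i i = 2) ∧ (∀ i j, i ≠ j → A i j ≤ 0) ∧ ∀ i j, A i j = 0 → A j i = 0

/-- `A` is indecomposable. -/
def Indecomposable {I : Type*} (A : Matrix I I ℤ) : Prop :=
  ∀ s : Set I, s.Nonempty → sᶜ.Nonempty → ∃ i ∈ s, ∃ j ∈ sᶜ, A i j ≠ 0

/-- `A` is symmetrizable: `D A` is symmetric for an invertible diagonal matrix `D`. -/
def Symmetrizable {I : Type*} (A : Matrix I I ℤ) : Prop :=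
  ∃ d : I → ℚ, (∀ i, d i ≠ 0) ∧ ∀ i j, d i * (A i j : ℚ) = d j * (A j i : ℚ)

/-- The principal submatrix of `A` indexed by a subset `S`. -/
def restrictM {I : Type*} (A : Matrix I I ℤ) (S : Set I) : Matrix S S ℤ :=
  fun i j => A i.1 j.1

/-- `A` is of finite type: `A u > 0` for some `u > 0` (Kac, Thm. 4.3). -/
def IsFiniteType {I : Type*} (A : Matrix I I ℤ) : Prop :=
  ∃ u : I → ℚ, (∀ i, 0 < u i) ∧ ∀ i, 0 < ∑ᶠ j, (A i j : ℚ) * u j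

/-- `A` is of affine type: `A` indecomposable and `A u = 0` for some `u > 0`. -/
def IsAffineType {I : Type*} (A : Matrix I I ℤ) : Prop :=
  Indecomposable A ∧ ∃ u : I → ℚ, (∀ i, 0 < u i) ∧ ∀ i, ∑ᶠ j, (A i j : ℚ) * u j = 0

/-- `A` is of indefinite type: `A u < 0` for some `u > 0`. -/
def IsIndefiniteType {I : Type*} (A : Matrix I I ℤ) : Prop :=
  ∃ u : I → ℚ, (∀ i, 0 < u i) ∧ ∀ i, ∑ᶠ j, (A i j : ℚ) * u j < 0

/-- The corank of a generalized Cartan matrix. -/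
def gcmCorank {I : Type*} [Fintype I] [DecidableEq I] (A : Matrix I I ℤ) : ℕ :=
  Fintype.card I - (A.map ((↑) : ℤ → ℚ)).rank

/-- The connected component of the vertex `k` in the subdiagram of the Dynkin diagram of `A`
with vertex set `S`. -/
def cmpnt {I : Type*} (A : Matrix I I ℤ) (S : Set I) (k : I) : Set I :=
  {i | i ∈ S ∧ Relation.ReflTransGen (fun x y => x ∈ S ∧ y ∈ S ∧ A x y ≠ 0) k i}

/-- `A` is hyperbolic: deleting any one vertex of the Dynkin diagram leaves a disjoint union
of diagrams of finite or affine type. -/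
def IsHyperbolic {I : Type*} (A : Matrix I I ℤ) : Prop :=
  ∀ i₀ k : I, k ≠ i₀ →
    IsFiniteType (restrictM A (cmpnt A {i | i ≠ i₀} k)) ∨
      IsAffineType (restrictM A (cmpnt A {i | i ≠ i₀} k))

/-- `A` is Lorentzian: `A` is nonsingular and its symmetrization has signature `(+,...,+,-)`. -/
def IsLorentzian {I : Type*} [Fintype I] [DecidableEq I] (A : Matrix I I ℤ) : Prop :=
  IsUnit (A.map ((↑) : ℤ → ℚ)).det ∧
    ∃ d : I → ℚ, (∀ i, 0 < d i) ∧ (∀ i j, d i * (A i j : ℚ) = d j * (A j i : ℚ)) ∧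
      ∃ P : Matrix I I ℝ, IsUnit P.det ∧ ∃ i₀ : I,
        P.transpose * (Matrix.of fun i j => ((d i : ℝ) * (A i j : ℝ))) * P =
          Matrix.diagonal fun i => if i = i₀ then (-1 : ℝ) else 1

/-! ### Weight spaces -/

variable {g : Type*} [LieRing g] [LieAlgebra ℂ g]

/-- The weight space of weight `χ` for the adjoint action on `g` of a space `V` mapping to `g`
by `ι`. -/
def wtSpaceι {V : Type*} [AddCommGroup V] [Module ℂ V] (ι : V →ₗ[ℂ] g)
    (χ : Module.Dual ℂ V) : Submodule ℂ g where
  carrier := {x | ∀ v : V, ⁅ι v, x⁆ = χ v • x}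
  add_mem' := fun ha hb v => by rw [lie_add, ha v, hb v, smul_add]
  zero_mem' := fun v => by rw [lie_zero, smul_zero]
  smul_mem' := fun c x hx v => by rw [lie_smul, hx v, smul_comm]

/-! ### Kac-Moody algebras -/

/-- A (symmetrizable) Kac-Moody algebra structure on the Lie algebra `g`, for the generalized
Cartan matrix `A` indexed by `I` : a realization `(H, root, coroot)` of `A` together with
Chevalley generators `e i`, `f i` satisfying the Chevalley-Serre relations, such that `g` is
generated by `H` and the `e i, f i`, is diagonalizable under `H`, with `0`-weight space `H`. -/
structure KacMoodyAlgebra {I : Type*} [Fintype I] [DecidableEq I] (A : Matrix I I ℤ)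
    (g : Type*) [LieRing g] [LieAlgebra ℂ g] : Type _ where
  H : Submodule ℂ g
  root : I → Module.Dual ℂ H
  coroot : I → H
  e : I → g
  f : I → g
  findimH : FiniteDimensional ℂ H
  finrankH : Module.finrank ℂ H = Fintype.card I + gcmCorank A
  indepRoot : LinearIndependent ℂ root
  indepCoroot : LinearIndependent ℂ coroot
  pairing : ∀ i j, root j (coroot i) = (A i j : ℂ)
  abelian : ∀ x y : H, ⁅(x : g), (y : g)⁆ = 0
  lie_e : ∀ (x : H) (i : I), ⁅(x : g), e i⁆ = root i x • e i
  lie_f : ∀ (x : H) (i : I), ⁅(x : g), f i⁆ = -(root i x) • f i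
  e_f : ∀ i j, ⁅e i, f j⁆ = if j = i then ((coroot i : g)) else 0
  serre_e : ∀ i j, i ≠ j →
    ((LieAlgebra.ad ℂ g (e i)) ^ (1 - A i j).toNat) (e j) = 0
  serre_f : ∀ i j, i ≠ j →
    ((LieAlgebra.ad ℂ g (f i)) ^ (1 - A i j).toNat) (f j) = 0
  generates : LieSubalgebra.lieSpan ℂ g ((H : Set g) ∪ Set.range e ∪ Set.range f) = ⊤
  weight_decomp : ⨆ χ : Module.Dual ℂ H, wtSpaceι H.subtype χ = ⊤
  zero_weight : wtSpaceι H.subtype (0 : Module.Dual ℂ H) = H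

variable {I : Type*} [Fintype I] [DecidableEq I] {A : Matrix I I ℤ}

/-- The root system of a Kac-Moody algebra: nonzero weights of the adjoint action of the
Cartan subalgebra. -/
def Delta (G : KacMoodyAlgebra A g) : Set (Module.Dual ℂ G.H) :=
  {χ | χ ≠ 0 ∧ wtSpaceι G.H.subtype χ ≠ ⊥}

/-- The positive roots with respect to the standard root basis. -/
def posRoots (G : KacMoodyAlgebra A g) : Set (Module.Dual ℂ G.H) :=
  {χ ∈ Delta G | ∃ c : I → ℕ, χ = ∑ i, (c i : ℂ) • G.root i}

/-- The real roots : the orbit of the simple roots under the Weyl group. -/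
inductive IsRealRoot (G : KacMoodyAlgebra A g) : Module.Dual ℂ G.H → Prop
  | simple (i : I) : IsRealRoot G (G.root i)
  | reflect (i : I) (χ : Module.Dual ℂ G.H) :
      IsRealRoot G χ → IsRealRoot G (χ - χ (G.coroot i) • G.root i)

/-- The subalgebra `g(S)` generated by the root spaces `g_{± α_i}`, `i ∈ S`. -/
def gS (G : KacMoodyAlgebra A g) (S : Set I) : LieSubalgebra ℂ g :=
  LieSubalgebra.lieSpan ℂ g ({x | ∃ i ∈ S, x = G.e i} ∪ {x | ∃ i ∈ S, x = G.f i})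

/-- The subspace `h^J = {h ∈ h | ⟨α_j, h⟩ = 0 ∀ j ∈ J}`. -/
def hJsub (G : KacMoodyAlgebra A g) (J : Set I) : Submodule ℂ G.H :=
  ⨅ j ∈ J, LinearMap.ker (G.root j)

/-- `Hk` is the canonical semisimple element attached to `k` and the component `S = I_k` :
it lies in the span of the coroots from `S` and satisfies `⟨α_i, H_k⟩ = 2 δ_{i,k}` on `S`. -/
def IsHGen (G : KacMoodyAlgebra A g) (S : Set I) (k : I) (Hk : G.H) : Prop :=
  Hk ∈ Submodule.span ℂ (G.coroot '' S) ∧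
    ∀ i ∈ S, G.root i Hk = if i = k then 2 else 0

/-- `g(S)` is `A₁`-graded by the `sl₂`-triple with semisimple element `Hk` :
`ad Hk` has only eigenvalues `0, 2, -2` on `g(S)`. -/
def A1GradedBy (G : KacMoodyAlgebra A g) (S : Set I) (Hk : g) : Prop :=
  ∀ x ∈ gS G S, x ∈ Module.End.eigenspace (LieAlgebra.ad ℂ g Hk) 0 ⊔
    Module.End.eigenspace (LieAlgebra.ad ℂ g Hk) 2 ⊔
      Module.End.eigenspace (LieAlgebra.ad ℂ g Hk) (-2)

/-- The pair `(I_k, J_k)` (for `I_k` the connected component of `k` in `J ∪ {k}`) is an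
irreducible `C`-admissible pair. -/
def CAdmissibleComponent (G : KacMoodyAlgebra A g) (J : Set I) (k : I) : Prop :=
  IsFiniteType (restrictM A (cmpnt A (J ∪ {k}) k)) ∧
    ∃ Hk : G.H, IsHGen G (cmpnt A (J ∪ {k}) k) k Hk ∧
      ∃ E F : g, E ∈ gS G (cmpnt A (J ∪ {k}) k) ∧ F ∈ gS G (cmpnt A (J ∪ {k}) k) ∧
        IsSl2Triple (Hk : g) E F ∧ A1GradedBy G (cmpnt A (J ∪ {k}) k) (Hk : g)

/-- The data of a `C`-admissible pair `(I, J)` : for each `k ∉ J`, the component `I_k` is of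
finite type and carries an `sl₂`-triple `(E_k, H_k, F_k)` which `A₁`-grades `g(I_k)`. -/
structure CAdmissibleData (G : KacMoodyAlgebra A g) (J : Set I) : Type _ where
  finJ : IsFiniteType (restrictM A J)
  Hc : {k : I // k ∉ J} → G.H
  E : {k : I // k ∉ J} → g
  F : {k : I // k ∉ J} → g
  finIk : ∀ k : {k : I // k ∉ J}, IsFiniteType (restrictM A (cmpnt A (J ∪ {k.1}) k.1))
  isHGen : ∀ k, IsHGen G (cmpnt A (J ∪ {k.1}) k.1) k.1 (Hc k)
  memE : ∀ k, E k ∈ gS G (cmpnt A (J ∪ {k.1}) k.1)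
  memF : ∀ k, F k ∈ gS G (cmpnt A (J ∪ {k.1}) k.1)
  sl2 : ∀ k, IsSl2Triple ((Hc k : g)) (E k) (F k)
  a1 : ∀ k, A1GradedBy G (cmpnt A (J ∪ {k.1}) k.1) ((Hc k : g))

/-- `(I,J)` is a `C`-admissible pair. -/
def CAdmissiblePair (G : KacMoodyAlgebra A g) (J : Set I) : Prop :=
  Nonempty (CAdmissibleData G J)

/-- The data of a `C`-admissible pair `(Itot, J)` for a subdiagram `Itot ⊆ I`. -/
structure CAdmissibleDataIn (G : KacMoodyAlgebra A g) (Itot J : Set I) : Type _ where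
  subJ : J ⊆ Itot
  finJ : IsFiniteType (restrictM A J)
  Hc : {k : I // k ∈ Itot ∧ k ∉ J} → G.H
  E : {k : I // k ∈ Itot ∧ k ∉ J} → g
  F : {k : I // k ∈ Itot ∧ k ∉ J} → g
  finIk : ∀ k : {k : I // k ∈ Itot ∧ k ∉ J},
    IsFiniteType (restrictM A (cmpnt A (J ∪ {k.1}) k.1))
  isHGen : ∀ k, IsHGen G (cmpnt A (J ∪ {k.1}) k.1) k.1 (Hc k)
  memE : ∀ k, E k ∈ gS G (cmpnt A (J ∪ {k.1}) k.1)
  memF : ∀ k, F k ∈ gS G (cmpnt A (J ∪ {k.1}) k.1)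
  sl2 : ∀ k, IsSl2Triple ((Hc k : g)) (E k) (F k)
  a1 : ∀ k, A1GradedBy G (cmpnt A (J ∪ {k.1}) k.1) ((Hc k : g))

/-- The `C`-admissible subalgebra `g^J` : generated by `h^J` and the `E_k, F_k`. -/
def CAdmissibleData.gJ {G : KacMoodyAlgebra A g} {J : Set I} (D : CAdmissibleData G J) :
    LieSubalgebra ℂ g :=
  LieSubalgebra.lieSpan ℂ g
    ((((hJsub G J).map G.H.subtype : Submodule ℂ g) : Set g) ∪ Set.range D.E ∪ Set.range D.F)

/-- `GJ` is "the" Kac-Moody structure on `g^J` associated to a `C`-admissible pair: its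
Cartan subalgebra is `h^J`, its coroots are the `H_k` and its Chevalley generators are the
`E_k, F_k`; the matrix `A'` is `A^J`, i.e. `a'_{k,l} = ⟨α_l, H_k⟩`. -/
def CAdmissibleData.IsAssocKM {G : KacMoodyAlgebra A g} {J : Set I} (D : CAdmissibleData G J)
    {A' : Matrix {k : I // k ∉ J} {k : I // k ∉ J} ℤ}
    (GJ : KacMoodyAlgebra A' ↥D.gJ) : Prop :=
  (∀ k l, (A' k l : ℂ) = G.root l.1 (D.Hc k)) ∧
  GJ.H.map D.gJ.toSubmodule.subtype = (hJsub G J).map G.H.subtype ∧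
  (∀ k, ((GJ.coroot k : ↥D.gJ) : g) = ((D.Hc k : ↥G.H) : g)) ∧
  (∀ k, ((GJ.e k : ↥D.gJ) : g) = D.E k) ∧ (∀ k, ((GJ.f k : ↥D.gJ) : g) = D.F k)

/-! ### Finite gradations -/

/-- `g` is finitely `Σ`-graded, where `Σ` is the root system of the Kac-Moody algebra `m`
(with Kac-Moody structure `M`) and `m` is embedded in `g` by `φ` (the grading subalgebra is
the image of `φ`): `g` is the sum of the weight spaces `V_γ`, `γ ∈ Σ ∪ {0}`, of the adjoint
action of the Cartan subalgebra of `m`, and each `V_γ` is finite dimensional. -/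
def IsFinGrading {S : Type*} [Fintype S] [DecidableEq S] {B : Matrix S S ℤ}
    {m : Type*} [LieRing m] [LieAlgebra ℂ m] (M : KacMoodyAlgebra B m)
    (φ : m →ₗ⁅ℂ⁆ g) : Prop :=
  Function.Injective φ ∧
  (⨆ χ ∈ insert (0 : Module.Dual ℂ M.H) (Delta M),
      wtSpaceι (φ.toLinearMap ∘ₗ M.H.subtype) χ) = ⊤ ∧
  ∀ χ ∈ insert (0 : Module.Dual ℂ M.H) (Delta M),
      FiniteDimensional ℂ (wtSpaceι (φ.toLinearMap ∘ₗ M.H.subtype) χ)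

section Grading

variable {S : Type*} [Fintype S] [DecidableEq S] {B : Matrix S S ℤ}
variable {m : Type*} [LieRing m] [LieAlgebra ℂ m]

/-- The inclusion of the Cartan subalgebra of the grading subalgebra into the Cartan
subalgebra of `g` (given `a ⊆ h`). -/
def cartanIncl (G : KacMoodyAlgebra A g) (M : KacMoodyAlgebra B m) (φ : m →ₗ⁅ℂ⁆ g)
    (hle : M.H.map φ.toLinearMap ≤ G.H) : M.H →ₗ[ℂ] G.H :=
  LinearMap.codRestrict G.H (φ.toLinearMap ∘ₗ M.H.subtype)
    (fun x => hle (Submodule.mem_map_of_mem x.2))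

/-- The restriction `ρ_a(χ)` to the Cartan subalgebra `a` of `m` of a linear form `χ` on `h`. -/
def resD (G : KacMoodyAlgebra A g) (M : KacMoodyAlgebra B m) (φ : m →ₗ⁅ℂ⁆ g)
    (hle : M.H.map φ.toLinearMap ≤ G.H) (χ : Module.Dual ℂ G.H) : Module.Dual ℂ M.H :=
  χ.comp (cartanIncl G M φ hle)

/-- The restriction `ρ_a(α_i)` of the simple root `α_i` to `a`. -/
def resRoot (G : KacMoodyAlgebra A g) (M : KacMoodyAlgebra B m) (φ : m →ₗ⁅ℂ⁆ g)
    (hle : M.H.map φ.toLinearMap ≤ G.H) (i : I) : Module.Dual ℂ M.H :=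
  resD G M φ hle (G.root i)

/-- The root basis of `M` is adapted to the root basis of `G` :
`ρ_a(Δ⁺) ⊆ Σ⁺ ∪ {0}`. -/
def Adapted (G : KacMoodyAlgebra A g) (M : KacMoodyAlgebra B m) (φ : m →ₗ⁅ℂ⁆ g)
    (hle : M.H.map φ.toLinearMap ≤ G.H) : Prop :=
  ∀ χ ∈ posRoots G, resD G M φ hle χ = 0 ∨ resD G M φ hle χ ∈ posRoots M

/-- The set `J = {i ∈ I | ρ_a(α_i) = 0}`. -/
def Jof (G : KacMoodyAlgebra A g) (M : KacMoodyAlgebra B m) (φ : m →ₗ⁅ℂ⁆ g)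
    (hle : M.H.map φ.toLinearMap ≤ G.H) : Set I :=
  {i | resRoot G M φ hle i = 0}

/-- The set `Γ_s = {i ∈ I' | ρ_a(α_i) = γ_s}`. -/
def GammaOf (G : KacMoodyAlgebra A g) (M : KacMoodyAlgebra B m) (φ : m →ₗ⁅ℂ⁆ g)
    (hle : M.H.map φ.toLinearMap ≤ G.H) (s : S) : Set I :=
  {i | resRoot G M φ hle i = M.root s}

/-- The set `I'_re = {i ∈ I' | ρ_a(α_i) ∈ Π_a}`. -/
def IpRe (G : KacMoodyAlgebra A g) (M : KacMoodyAlgebra B m) (φ : m →ₗ⁅ℂ⁆ g)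
    (hle : M.H.map φ.toLinearMap ≤ G.H) : Set I :=
  {i | ∃ s : S, resRoot G M φ hle i = M.root s}

/-- The set `I'_im = {i ∈ I | ρ_a(α_i) ∉ Π_a ∪ {0}}`. -/
def IpIm (G : KacMoodyAlgebra A g) (M : KacMoodyAlgebra B m) (φ : m →ₗ⁅ℂ⁆ g)
    (hle : M.H.map φ.toLinearMap ≤ G.H) : Set I :=
  {i | resRoot G M φ hle i ≠ 0 ∧ ∀ s : S, resRoot G M φ hle i ≠ M.root s}

/-- The set `I_re` : union of the components `I_k`, `k ∈ I'_re`. -/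
def IreOf (G : KacMoodyAlgebra A g) (M : KacMoodyAlgebra B m) (φ : m →ₗ⁅ℂ⁆ g)
    (hle : M.H.map φ.toLinearMap ≤ G.H) : Set I :=
  {i | ∃ k ∈ IpRe G M φ hle, i ∈ cmpnt A (Jof G M φ hle ∪ {k}) k}

/-- `g` is maximally finitely graded: finitely graded, with `a ⊆ h`, the root basis of the
grading subalgebra adapted, and the corresponding sets `J` and `I'_im` empty. -/
def MaxFinGrading (G : KacMoodyAlgebra A g) (M : KacMoodyAlgebra B m) (φ : m →ₗ⁅ℂ⁆ g) : Prop :=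
  IsFinGrading M φ ∧ ∃ hle : M.H.map φ.toLinearMap ≤ G.H,
    Adapted G M φ hle ∧ Jof G M φ hle = ∅ ∧ IpIm G M φ hle = ∅

end Grading

/-- `(π, πv)` is a root basis (with generalized Cartan matrix `B`) of the root system `Rts`. -/
def IsRootBasis {V : Type*} [AddCommGroup V] [Module ℂ V] {S : Type*} [Fintype S]
    (B : Matrix S S ℤ) (Rts : Set (Module.Dual ℂ V)) (π : S → Module.Dual ℂ V)
    (πv : S → V) : Prop :=
  LinearIndependent ℂ π ∧ LinearIndependent ℂ πv ∧
  (∀ s t, π t (πv s) = (B s t : ℂ)) ∧ (∀ s, π s ∈ Rts) ∧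
  ∀ χ ∈ Rts, (∃ c : S → ℕ, χ = ∑ s, (c s : ℂ) • π s) ∨
    (∃ c : S → ℕ, χ = -∑ s, (c s : ℂ) • π s)

/-- `Bf` is a nondegenerate invariant symmetric bilinear form on `g`. -/
def InvariantForm (Bf : g →ₗ[ℂ] g →ₗ[ℂ] ℂ) : Prop :=
  (∀ x y, Bf x y = Bf y x) ∧ (∀ x y z, Bf ⁅x, y⁆ z = Bf x ⁅y, z⁆) ∧
  ∀ x, (∀ y, Bf x y = 0) → x = 0

/-- `Bf` is "the" invariant bilinear form of the Kac-Moody algebra `G` : nondegenerate,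
invariant, symmetric, with `(α_i∨, α_i∨)` a positive rational for all `i`. -/
def NormalizedInvForm (G : KacMoodyAlgebra A g) (Bf : g →ₗ[ℂ] g →ₗ[ℂ] ℂ) : Prop :=
  InvariantForm Bf ∧ ∀ i : I, ∃ q : ℚ, 0 < q ∧ Bf ((G.coroot i : g)) ((G.coroot i : g)) = (q : ℂ)

/-- `(e', f')` is a system of Chevalley generators for `G` (with the given Cartan subalgebra,
simple roots and coroots). -/
def IsChevalleyGens (G : KacMoodyAlgebra A g) (e' f' : I → g) : Prop :=
  (∀ (x : G.H) (i : I), ⁅(x : g), e' i⁆ = G.root i x • e' i) ∧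
  (∀ (x : G.H) (i : I), ⁅(x : g), f' i⁆ = -(G.root i x) • f' i) ∧
  (∀ i j, ⁅e' i, f' j⁆ = if j = i then ((G.coroot i : g)) else 0) ∧
  (∀ i j, i ≠ j → ((LieAlgebra.ad ℂ g (e' i)) ^ (1 - A i j).toNat) (e' j) = 0) ∧
  (∀ i j, i ≠ j → ((LieAlgebra.ad ℂ g (f' i)) ^ (1 - A i j).toNat) (f' j) = 0) ∧
  LieSubalgebra.lieSpan ℂ g ((G.H : Set g) ∪ Set.range e' ∪ Set.range f') = ⊤


/-- The subalgebra `g(I_re)` of `g` generated by `h_{I_re}` and the `e_i, f_i`, `i ∈ I_re`. -/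
def gIre (G : KacMoodyAlgebra A g) (Ire : Set I) (hIre : Submodule ℂ g) : LieSubalgebra ℂ g :=
  LieSubalgebra.lieSpan ℂ g
    ((hIre : Set g) ∪ {x | ∃ i ∈ Ire, x = G.e i} ∪ {x | ∃ i ∈ Ire, x = G.f i})

/-- `GI` is "the" Kac-Moody structure on `g(I_re)` : its Cartan subalgebra is `h_{I_re}`,
its coroots and Chevalley generators are the `α_i∨, e_i, f_i` of `g`, for `i ∈ I_re`. -/
def IsAssocKMIre (G : KacMoodyAlgebra A g) (Ire : Set I) (hIre : Submodule ℂ g)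
    {A'' : Matrix ↥Ire ↥Ire ℤ} (GI : KacMoodyAlgebra A'' ↥(gIre G Ire hIre)) : Prop :=
  GI.H.map (gIre G Ire hIre).toSubmodule.subtype = hIre ∧
  (∀ i, ((GI.coroot i : ↥(gIre G Ire hIre)) : g) = ((G.coroot i.1 : ↥G.H) : g)) ∧
  (∀ i, ((GI.e i : ↥(gIre G Ire hIre)) : g) = G.e i.1) ∧
  (∀ i, ((GI.f i : ↥(gIre G Ire hIre)) : g) = G.f i.1)

/-! ### Admissible quotients and maximal gradations -/

/-- `ρ : I → S` is an admissible quotient map for `A` : fibers are totally disconnected (MG1)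
and the column sums over a fiber are constant along fibers (MG2). -/
def AdmissibleQuotient {I S : Type*} (A : Matrix I I ℤ) (ρ : I → S) : Prop :=
  Function.Surjective ρ ∧
  (∀ k l, k ≠ l → ρ k = ρ l → A k l = 0) ∧
  ∀ s t : S, s ≠ t → ∀ j j', ρ j = t → ρ j' = t →
    ∑ᶠ i ∈ {i | ρ i = s}, A i j = ∑ᶠ i ∈ {i | ρ i = s}, A i j'

section Quotient

variable {S : Type*} [Fintype S] [DecidableEq S]

/-- `γ_s∨ = ∑_{k ∈ Γ_s} α_k∨`. -/
def gammaV (G : KacMoodyAlgebra A g) (ρ : I → S) (s : S) : G.H :=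
  ∑ᶠ k ∈ {k | ρ k = s}, G.coroot k

/-- `X̄_s = ∑_{k ∈ Γ_s} e_k`. -/
def Xbar (G : KacMoodyAlgebra A g) (ρ : I → S) (s : S) : g :=
  ∑ᶠ k ∈ {k | ρ k = s}, G.e k

/-- `Ȳ_s = ∑_{k ∈ Γ_s} f_k`. -/
def Ybar (G : KacMoodyAlgebra A g) (ρ : I → S) (s : S) : g :=
  ∑ᶠ k ∈ {k | ρ k = s}, G.f k

/-- The subalgebra `g^ρ` generated by `a` and the `X̄_s, Ȳ_s`. -/
def gRho (G : KacMoodyAlgebra A g) (ρ : I → S) (a : Submodule ℂ G.H) : LieSubalgebra ℂ g :=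
  LieSubalgebra.lieSpan ℂ g
    (((a.map G.H.subtype : Submodule ℂ g) : Set g) ∪ Set.range (Xbar G ρ) ∪
      Set.range (Ybar G ρ))

/-- `Gρ` is "the" Kac-Moody structure on `g^ρ` : its Cartan subalgebra is `a`, its coroots
are the `γ_s∨` and its Chevalley generators are the `X̄_s, Ȳ_s`. -/
def IsAssocKMrho (G : KacMoodyAlgebra A g) (ρ : I → S) (a : Submodule ℂ G.H)
    {Abar : Matrix S S ℤ} (Gρ : KacMoodyAlgebra Abar ↥(gRho G ρ a)) : Prop :=
  Gρ.H.map (gRho G ρ a).toSubmodule.subtype = a.map G.H.subtype ∧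
  (∀ s, ((Gρ.coroot s : ↥(gRho G ρ a)) : g) = ((gammaV G ρ s : ↥G.H) : g)) ∧
  (∀ s, ((Gρ.e s : ↥(gRho G ρ a)) : g) = Xbar G ρ s) ∧
  (∀ s, ((Gρ.f s : ↥(gRho G ρ a)) : g) = Ybar G ρ s)

end Quotient

end KMG

namespace KMG

open Module

section WeightSpaces

variable {g : Type*} [LieRing g] [LieAlgebra ℂ g] {V : Type*} [AddCommGroup V] [Module ℂ V]
  {ι : V →ₗ[ℂ] g}

theorem lie_mem_wtSpaceι {χ ψ : Dual ℂ V} {x y : g} (hx : x ∈ wtSpaceι ι χ)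
    (hy : y ∈ wtSpaceι ι ψ) : ⁅x, y⁆ ∈ wtSpaceι ι (χ + ψ) := fun v => by
  rw [leibniz_lie, hx v, hy v, lie_smul, smul_lie, ← add_smul, LinearMap.add_apply]

theorem iSupIndep_wtSpaceι (hι : ∀ v w, ⁅ι v, ι w⁆ = 0) : iSupIndep (wtSpaceι ι) := by
  have h := Module.End.independent_iInf_maxGenEigenspace_of_forall_mapsTo
    (fun v : V => LieAlgebra.ad ℂ g (ι v)) (fun v w φ =>
      Module.End.mapsTo_maxGenEigenspace_of_comm (by
        ext x
        have := leibniz_lie (ι w) (ι v) x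
        rw [hι, zero_lie, zero_add] at this
        exact this) φ)
  refine (h.comp (f := fun χ : Dual ℂ V => (χ : V → ℂ)) DFunLike.coe_injective).mono
    fun χ x hx => ?_
  simp only [Function.comp, Submodule.mem_iInf]
  intro v
  have h1 : x ∈ Module.End.eigenspace (LieAlgebra.ad ℂ g (ι v)) (χ v) :=
    Module.End.mem_eigenspace_iff.2 (hx v)
  exact (Module.End.genEigenspace (LieAlgebra.ad ℂ g (ι v)) (χ v)).monotone le_top h1

/-- If submodules of the weight spaces span everything, then they are the weight spaces. -/
theorem eq_wtSpaceι_of_iSup_eq_top (hι : ∀ v w, ⁅ι v, ι w⁆ = 0) {N : Dual ℂ V → Submodule ℂ g}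
    (hN : ∀ χ, N χ ≤ wtSpaceι ι χ) (htop : ⨆ χ, N χ = ⊤) (χ : Dual ℂ V) :
    N χ = wtSpaceι ι χ := by
  refine le_antisymm (hN χ) fun x hx => ?_
  have hx' : x ∈ N χ ⊔ ⨆ ψ ≠ χ, N ψ := by
    rw [← iSup_split_single N χ, htop]; trivial
  obtain ⟨a, ha, b, hb, rfl⟩ := Submodule.mem_sup.1 hx'
  have hb' : b ∈ ⨆ ψ ≠ χ, wtSpaceι ι ψ := iSup₂_mono (fun ψ _ => hN ψ) hb
  have hb'' : b ∈ wtSpaceι ι χ := by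
    simpa using Submodule.sub_mem _ hx (hN χ ha)
  have := (Submodule.disjoint_def.1 (iSupIndep_wtSpaceι hι χ)) b hb'' hb'
  simpa [this] using ha

end WeightSpaces

section Sl2

variable {g : Type*} [LieRing g] [LieAlgebra ℂ g] {h e f : g}

theorem lie_ad_pow_of_lie_eq {c μ : ℂ} {x : g} (hf : ⁅h, f⁆ = c • f) (hx : ⁅h, x⁆ = μ • x)
    (p : ℕ) :
    ⁅h, (LieAlgebra.ad ℂ g f ^ p) x⁆ = (μ + p * c) • (LieAlgebra.ad ℂ g f ^ p) x := by
  induction p with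
  | zero => simpa using hx
  | succ p ih =>
    rw [pow_succ', Module.End.mul_apply, LieAlgebra.ad_apply, leibniz_lie, hf, ih, smul_lie,
      lie_smul, ← add_smul]
    congr 1
    push_cast
    ring

/-- Strings in locally nilpotent `sl₂`-modules are unbroken. -/
theorem exists_ad_pow_ad_pow_ne_zero (t : IsSl2Triple h e f) {x : g} (hx : x ≠ 0) {m : ℕ}
    (hm : ⁅h, x⁆ = -(m : ℂ) • x) (hf : ∃ r, (LieAlgebra.ad ℂ g f ^ r) x = 0) {j : ℕ}
    (hj : j ≤ m) :
    ∃ p, (LieAlgebra.ad ℂ g e ^ (p + j)) ((LieAlgebra.ad ℂ g f ^ p) x) ≠ 0 := by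
  classical
  obtain ⟨p, hp⟩ : ∃ p, Nat.find hf = p + 1 := Nat.exists_eq_succ_of_ne_zero fun h0 => by
    have := Nat.find_spec hf
    rw [h0] at this
    exact hx (by simpa using this)
  have h1 : (LieAlgebra.ad ℂ g f ^ p) x ≠ 0 := Nat.find_min hf (by omega)
  have h2 : ⁅f, (LieAlgebra.ad ℂ g f ^ p) x⁆ = 0 := by
    have := Nat.find_spec hf
    rwa [hp, pow_succ'] at this
  have h3 := lie_ad_pow_of_lie_eq (h := h) (f := f) (c := -2)
    (by rw [t.lie_lie_smul_f ℂ, neg_smul]) hm p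
  have P : t.symm.HasPrimitiveVectorWith ((LieAlgebra.ad ℂ g f ^ p) x) ((m : ℂ) + 2 * p) :=
    ⟨h1, by rw [neg_lie, h3, ← neg_smul]; congr 1; ring, h2⟩
  refine ⟨p, ?_⟩
  have key : ∀ q : ℕ, q ≤ m + 2 * p →
      (LieAlgebra.ad ℂ g e ^ q) ((LieAlgebra.ad ℂ g f ^ p) x) ≠ 0 := by
    intro q
    induction q with
    | zero => intro _; simpa using h1
    | succ q ih =>
      intro hq h0
      have h4 := P.lie_e_pow_succ_toEnd_f q
      have h0' : ((LieModule.toEnd ℂ g g e) ^ (q + 1)) ((LieAlgebra.ad ℂ g f ^ p) x) = 0 := h0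
      rw [h0', lie_zero] at h4
      have h5 := (smul_eq_zero.1 h4.symm).resolve_right (ih (by omega))
      rcases mul_eq_zero.1 h5 with h6 | h6
      · exact Nat.cast_add_one_ne_zero q h6
      · have : ((m + 2 * p : ℕ) : ℂ) = (q : ℕ) := by
          push_cast; linear_combination h6
        have := Nat.cast_injective this
        omega
  exact key _ (by omega)

end Sl2

namespace KacMoodyAlgebra

variable {g : Type*} [LieRing g] [LieAlgebra ℂ g] {S : Type*} [Fintype S] [DecidableEq S]
  {B : Matrix S S ℤ} (K : KacMoodyAlgebra B g)

/-- The opposite Kac-Moody structure, exchanging the roles of the `e i` and the `f i`. -/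
def opp : KacMoodyAlgebra B g where
  H := K.H
  root i := -K.root i
  coroot i := -K.coroot i
  e := K.f
  f := K.e
  findimH := K.findimH
  finrankH := K.finrankH
  indepRoot := by
    have := K.indepRoot.units_smul (fun _ => (-1 : ℂˣ))
    convert this using 1
    ext i; simp
  indepCoroot := by
    have := K.indepCoroot.units_smul (fun _ => (-1 : ℂˣ))
    convert this using 1
    ext i; simp
  pairing i j := by simp [K.pairing]
  abelian := K.abelian
  lie_e x i := by simp [K.lie_f]
  lie_f x i := by simp [K.lie_e]
  e_f i j := by
    rw [← lie_skew, K.e_f]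
    by_cases h : i = j
    · subst h; simp
    · rw [if_neg h, if_neg (Ne.symm h), neg_zero]
  serre_e := K.serre_f
  serre_f := K.serre_e
  generates := by
    rw [← K.generates, Set.union_assoc, Set.union_assoc, Set.union_comm (Set.range K.f)]
  weight_decomp := K.weight_decomp
  zero_weight := K.zero_weight

theorem opp_opp : K.opp.opp = K := by
  cases K
  unfold opp
  congr 1
  · exact funext fun i => neg_neg _
  · exact funext fun i => neg_neg _

/-- The element of the root lattice with given coordinates in the basis of simple roots. -/
def ofCoord (n : S → ℤ) : Dual ℂ K.H := ∑ i, (n i : ℂ) • K.root i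

theorem ofCoord_add (n m : S → ℤ) : K.ofCoord (n + m) = K.ofCoord n + K.ofCoord m := by
  simp [ofCoord, add_smul, Finset.sum_add_distrib]

theorem ofCoord_neg (n : S → ℤ) : K.ofCoord (-n) = -K.ofCoord n := by
  simp [ofCoord]

@[simp] theorem ofCoord_zero : K.ofCoord 0 = 0 := by simp [ofCoord]

@[simp] theorem ofCoord_single (i : S) (z : ℤ) :
    K.ofCoord (Pi.single i z) = (z : ℂ) • K.root i := by
  unfold ofCoord
  rw [Finset.sum_eq_single i (fun j _ hj => by rw [Pi.single_eq_of_ne hj]; simp) (by simp)]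
  simp

theorem ofCoord_injective : Function.Injective K.ofCoord := by
  intro n m h
  have := Fintype.linearIndependent_iff.1 K.indepRoot (fun i => (n i : ℂ) - (m i : ℂ)) (by
    simp only [sub_smul, Finset.sum_sub_distrib]
    exact sub_eq_zero.2 h)
  ext i
  exact_mod_cast sub_eq_zero.1 (this i)

theorem opp_ofCoord (n : S → ℤ) : K.opp.ofCoord n = K.ofCoord (-n) := by
  rw [ofCoord_neg]
  unfold ofCoord
  rw [← Finset.sum_neg_distrib]
  exact Finset.sum_congr rfl fun i _ => smul_neg _ _

theorem ofCoord_coroot (n : S → ℤ) (i : S) : K.ofCoord n (K.coroot i) = ((B.mulVec n) i : ℤ) := by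
  simp [ofCoord, K.pairing, Matrix.mulVec, dotProduct, mul_comm]

/-- The weight space attached to an element of the root lattice. -/
def wt (n : S → ℤ) : Submodule ℂ g := wtSpaceι K.H.subtype (K.ofCoord n)

/-- The coordinates of the weights of the adjoint representation. -/
def weights : Set (S → ℤ) := {n | K.wt n ≠ ⊥}

theorem opp_wt (n : S → ℤ) : K.opp.wt n = K.wt (-n) := by
  unfold wt
  rw [opp_ofCoord]
  rfl

theorem opp_weights : K.opp.weights = -K.weights := by
  ext n
  simp [weights, opp_wt]

theorem wt_zero : K.wt 0 = K.H := by
  rw [wt, ofCoord_zero, K.zero_weight]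

theorem lie_mem_wt {n m : S → ℤ} {x y : g} (hx : x ∈ K.wt n) (hy : y ∈ K.wt m) :
    ⁅x, y⁆ ∈ K.wt (n + m) := by
  rw [wt, ofCoord_add]
  exact lie_mem_wtSpaceι hx hy

theorem e_mem_wt (i : S) : K.e i ∈ K.wt (Pi.single i 1) := fun x => by
  simpa using K.lie_e x i

theorem f_mem_wt (i : S) : K.f i ∈ K.wt (-Pi.single i 1) := by
  rw [← K.opp_wt]
  exact K.opp.e_mem_wt i

theorem lie_H_of_mem_wt {n : S → ℤ} {x : g} (hx : x ∈ K.wt n) (h : K.H) :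
    ⁅(h : g), x⁆ = K.ofCoord n h • x := hx h

theorem e_ne_zero (i : S) : K.e i ≠ 0 := fun h => by
  have := K.e_f i i
  rw [h, zero_lie, if_pos rfl] at this
  exact K.indepCoroot.ne_zero i (Subtype.ext this.symm)

/-- Monomials obtained by bracketing elements of the Cartan subalgebra with the `e i`. -/
inductive IsMonomial : (S → ℤ) → g → Prop
  | base (h : K.H) : IsMonomial 0 (h : g)
  | step (i : S) (n : S → ℤ) (x : g) :
      IsMonomial n x → IsMonomial (n + Pi.single i 1) ⁅K.e i, x⁆

variable {K}

theorem IsMonomial.mem_wt {n : S → ℤ} {x : g} (h : K.IsMonomial n x) : x ∈ K.wt n := by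
  induction h with
  | base h => rw [K.wt_zero]; exact h.2
  | step i n x _ ih =>
    rw [add_comm]
    exact K.lie_mem_wt (K.e_mem_wt i) ih

theorem IsMonomial.nonneg {n : S → ℤ} {x : g} (h : K.IsMonomial n x) : 0 ≤ n := by
  induction h with
  | base h => exact le_rfl
  | step i n x _ ih =>
    exact add_nonneg ih (Pi.single_nonneg.2 zero_le_one)

variable (K) in
/-- The span of all monomials in the `e i` and in the `f i`. -/
def monomialSpan : Submodule ℂ g :=
  Submodule.span ℂ {x | ∃ n, K.IsMonomial n x ∨ K.opp.IsMonomial n x}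

theorem opp_monomialSpan : K.opp.monomialSpan = K.monomialSpan := by
  unfold monomialSpan
  congr 1
  ext x
  rw [opp_opp]
  exact exists_congr fun n => or_comm

theorem IsMonomial.mem_span {n : S → ℤ} {x : g} (h : K.IsMonomial n x) :
    x ∈ K.monomialSpan := Submodule.subset_span ⟨n, Or.inl h⟩

theorem coe_mem_monomialSpan (h : K.H) : (h : g) ∈ K.monomialSpan :=
  (IsMonomial.base h).mem_span

theorem IsMonomial.lie_coroot_mem {n : S → ℤ} {x : g} (h : K.IsMonomial n x) (y : K.H) :
    ⁅(y : g), x⁆ ∈ K.monomialSpan := by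
  rw [K.lie_H_of_mem_wt h.mem_wt]
  exact Submodule.smul_mem _ _ h.mem_span

theorem exists_root_eq_one (i : S) : ∃ h : K.H, K.root i h = 1 := by
  have : K.root i ≠ 0 := K.indepRoot.ne_zero i
  obtain ⟨h, hh⟩ := DFunLike.ne_iff.1 this
  exact ⟨(K.root i h)⁻¹ • h, by simp at hh; simp [hh]⟩

theorem e_mem_monomialSpan (i : S) : K.e i ∈ K.monomialSpan := by
  obtain ⟨h, hh⟩ := K.exists_root_eq_one i
  have h1 : ⁅K.e i, (h : g)⁆ = - K.e i := by
    rw [← lie_skew, K.lie_e, hh, one_smul]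
  have := (IsMonomial.step i 0 _ (IsMonomial.base h)).mem_span
  rw [h1] at this
  simpa using this

theorem f_mem_monomialSpan (i : S) : K.f i ∈ K.monomialSpan := by
  rw [← opp_monomialSpan]
  exact K.opp.e_mem_monomialSpan i

theorem lie_e_mem_span (i : S) {x : g} (hx : x ∈ Submodule.span ℂ {y | ∃ n, K.IsMonomial n y}) :
    ⁅K.e i, x⁆ ∈ Submodule.span ℂ {y | ∃ n, K.IsMonomial n y} := by
  induction hx using Submodule.span_induction with
  | mem z hz =>
    obtain ⟨m, hm⟩ := hz
    exact Submodule.subset_span ⟨_, IsMonomial.step i m z hm⟩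
  | zero => simp
  | add a b _ _ ha hb => rw [lie_add]; exact add_mem ha hb
  | smul c a _ ha => rw [lie_smul]; exact Submodule.smul_mem _ _ ha

theorem IsMonomial.eq_coe_or_lie_f_mem {n : S → ℤ} {x : g} (h : K.IsMonomial n x) (j : S) :
    (∃ y : K.H, x = y) ∨ ⁅K.f j, x⁆ ∈ Submodule.span ℂ {y | ∃ n, K.IsMonomial n y} := by
  induction h with
  | base h => exact Or.inl ⟨h, rfl⟩
  | step i n x hx ih =>
    right
    have h1 : ⁅K.f j, K.e i⁆ = -(if j = i then ((K.coroot i : g)) else 0) := by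
      rw [← lie_skew, K.e_f]
    rw [leibniz_lie, h1]
    refine add_mem ?_ ?_
    · split_ifs
      · rw [neg_lie, K.lie_H_of_mem_wt hx.mem_wt]
        exact neg_mem (Submodule.smul_mem _ _ (Submodule.subset_span ⟨n, hx⟩))
      · simp
    · rcases ih with ⟨y, rfl⟩ | ih
      · have h2 : ⁅K.f j, (y : g)⁆ = K.root j y • K.f j := by
          rw [← lie_skew, K.lie_f, neg_smul, neg_neg]
        rw [h2, lie_smul, K.e_f]
        refine Submodule.smul_mem _ _ ?_
        split_ifs
        · exact Submodule.subset_span ⟨0, IsMonomial.base _⟩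
        · exact zero_mem _
      · exact lie_e_mem_span i ih

theorem IsMonomial.lie_f_mem {n : S → ℤ} {x : g} (h : K.IsMonomial n x) (j : S) :
    ⁅K.f j, x⁆ ∈ K.monomialSpan := by
  rcases h.eq_coe_or_lie_f_mem j with ⟨y, rfl⟩ | h
  · rw [← lie_skew, K.lie_f, neg_smul, neg_neg]
    exact Submodule.smul_mem _ _ (f_mem_monomialSpan j)
  · exact Submodule.span_mono (by rintro y ⟨m, hm⟩; exact ⟨m, Or.inl hm⟩) h

theorem lie_f_mem_monomialSpan {x : g} (hx : x ∈ K.monomialSpan) (j : S) :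
    ⁅K.f j, x⁆ ∈ K.monomialSpan := by
  induction hx using Submodule.span_induction with
  | mem z hz =>
    obtain ⟨m, hm | hm⟩ := hz
    · exact hm.lie_f_mem j
    · rw [← opp_monomialSpan]
      exact (IsMonomial.step j m z hm).mem_span
  | zero => simp
  | add a b _ _ ha hb => rw [lie_add]; exact add_mem ha hb
  | smul c a _ ha => rw [lie_smul]; exact Submodule.smul_mem _ _ ha

theorem lie_e_mem_monomialSpan {x : g} (hx : x ∈ K.monomialSpan) (j : S) :
    ⁅K.e j, x⁆ ∈ K.monomialSpan := by
  rw [← opp_monomialSpan] at hx ⊢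
  exact K.opp.lie_f_mem_monomialSpan hx j

theorem lie_coe_mem_monomialSpan {x : g} (hx : x ∈ K.monomialSpan) (y : K.H) :
    ⁅(y : g), x⁆ ∈ K.monomialSpan := by
  induction hx using Submodule.span_induction with
  | mem z hz =>
    obtain ⟨m, hm | hm⟩ := hz
    · exact hm.lie_coroot_mem y
    · rw [← opp_monomialSpan]
      exact hm.lie_coroot_mem y
  | zero => simp
  | add a b _ _ ha hb => rw [lie_add]; exact add_mem ha hb
  | smul c a _ ha => rw [lie_smul]; exact Submodule.smul_mem _ _ ha

variable (K) in
theorem induction_lieSpan {p : LieSubalgebra ℂ g} (hH : ∀ y : K.H, (y : g) ∈ p)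
    (he : ∀ i, K.e i ∈ p) (hf : ∀ i, K.f i ∈ p) (x : g) : x ∈ p := by
  have : LieSubalgebra.lieSpan ℂ g ((K.H : Set g) ∪ Set.range K.e ∪ Set.range K.f) ≤ p := by
    rw [LieSubalgebra.lieSpan_le]
    rintro _ ((h | ⟨i, rfl⟩) | ⟨i, rfl⟩)
    · exact hH ⟨_, h⟩
    · exact he i
    · exact hf i
  rw [K.generates] at this
  exact this (LieSubalgebra.mem_top x)

/-- The Lie subalgebra of elements whose adjoint action stabilizes a submodule. -/
def stabilizer (W : Submodule ℂ g) : LieSubalgebra ℂ g where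
  carrier := {y | ∀ w ∈ W, ⁅y, w⁆ ∈ W}
  add_mem' ha hb w hw := by rw [add_lie]; exact add_mem (ha w hw) (hb w hw)
  zero_mem' w _ := by simp
  smul_mem' c a ha w hw := by rw [smul_lie]; exact W.smul_mem _ (ha w hw)
  lie_mem' {a b} ha hb w hw := by
    rw [lie_lie]; exact sub_mem (ha _ (hb _ hw)) (hb _ (ha _ hw))

variable (K) in
theorem monomialSpan_eq_top : K.monomialSpan = ⊤ := by
  have h1 : ∀ y, y ∈ stabilizer K.monomialSpan := K.induction_lieSpan
    (fun y w hw => lie_coe_mem_monomialSpan hw y) (fun i w hw => lie_e_mem_monomialSpan hw i)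
    (fun i w hw => lie_f_mem_monomialSpan hw i)
  let p : LieSubalgebra ℂ g := { K.monomialSpan with lie_mem' := fun {a b} _ hb => h1 a b hb }
  rw [eq_top_iff]
  intro x _
  exact K.induction_lieSpan (p := p) coe_mem_monomialSpan e_mem_monomialSpan f_mem_monomialSpan x

variable (K) in
theorem wtSpaceι_eq_span (χ : Dual ℂ K.H) : wtSpaceι K.H.subtype χ = Submodule.span ℂ
    {x | ∃ n, (K.ofCoord n = χ ∧ K.IsMonomial n x) ∨ (K.opp.ofCoord n = χ ∧ K.opp.IsMonomial n x)} := by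
  refine (eq_wtSpaceι_of_iSup_eq_top (fun v w => K.abelian v w) (N := fun χ => Submodule.span ℂ
    {x | ∃ n, (K.ofCoord n = χ ∧ K.IsMonomial n x) ∨
      (K.opp.ofCoord n = χ ∧ K.opp.IsMonomial n x)}) (fun χ => ?_) ?_ χ).symm
  · rw [Submodule.span_le]
    rintro x ⟨n, ⟨rfl, h⟩ | ⟨rfl, h⟩⟩
    · exact h.mem_wt
    · exact h.mem_wt
  · rw [eq_top_iff, ← K.monomialSpan_eq_top]
    refine Submodule.span_le.2 ?_
    rintro x ⟨n, h | h⟩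
    · exact Submodule.mem_iSup_of_mem (K.ofCoord n) (Submodule.subset_span ⟨n, Or.inl ⟨rfl, h⟩⟩)
    · exact Submodule.mem_iSup_of_mem (K.opp.ofCoord n)
        (Submodule.subset_span ⟨n, Or.inr ⟨rfl, h⟩⟩)

variable (K) in
theorem exists_mem_weights_of_wtSpaceι_ne_bot {χ : Dual ℂ K.H}
    (hχ : wtSpaceι K.H.subtype χ ≠ ⊥) : ∃ n ∈ K.weights, K.ofCoord n = χ ∧ (0 ≤ n ∨ n ≤ 0) := by
  by_contra! hn
  refine hχ ?_
  rw [K.wtSpaceι_eq_span, Submodule.span_eq_bot]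
  rintro x ⟨n, ⟨rfl, h⟩ | ⟨rfl, h⟩⟩
  · exact absurd h.nonneg (hn n hχ rfl).1
  · rw [opp_ofCoord] at hn hχ
    exact absurd (neg_nonpos.2 h.nonneg) (hn (-n) hχ rfl).2

theorem nonneg_or_nonpos {n : S → ℤ} (hn : n ∈ K.weights) : 0 ≤ n ∨ n ≤ 0 := by
  obtain ⟨m, -, h, h'⟩ := K.exists_mem_weights_of_wtSpaceι_ne_bot hn
  rwa [K.ofCoord_injective h] at h'

theorem wt_le_iSup_map {n : S → ℤ} (hn : 0 ≤ n) (hn0 : n ≠ 0) :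
    K.wt n ≤ ⨆ i, (K.wt (n - Pi.single i 1)).map (LieAlgebra.ad ℂ g (K.e i)) := by
  rw [wt, K.wtSpaceι_eq_span, Submodule.span_le]
  rintro x ⟨m, ⟨h, hm⟩ | ⟨h, hm⟩⟩
  · obtain rfl := K.ofCoord_injective h
    cases hm with
    | base h => exact absurd rfl hn0
    | step i m x hx =>
      refine Submodule.mem_iSup_of_mem i ⟨x, ?_, rfl⟩
      simpa using hx.mem_wt
  · rw [opp_ofCoord] at h
    obtain rfl := K.ofCoord_injective h
    exact absurd (le_antisymm (neg_nonpos.2 hm.nonneg) hn) hn0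

end KacMoodyAlgebra

theorem ad_pow_mem_wtSpaceι {g : Type*} [LieRing g] [LieAlgebra ℂ g] {V : Type*} [AddCommGroup V]
    [Module ℂ V] {ι : V →ₗ[ℂ] g} {χ ψ : Dual ℂ V} {x y : g} (hx : x ∈ wtSpaceι ι χ)
    (hy : y ∈ wtSpaceι ι ψ) (p : ℕ) :
    (LieAlgebra.ad ℂ g y ^ p) x ∈ wtSpaceι ι (χ + (p : ℂ) • ψ) := fun v => by
  rw [lie_ad_pow_of_lie_eq (hy v) (hx v) p]
  simp

/-- The combinatorial properties of the set of roots, together with `0`, of a Kac-Moody algebra,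
in terms of coordinates in a root basis. -/
structure IsRootLike {S : Type*} [Fintype S] [DecidableEq S] (B : Matrix S S ℤ)
    (X : Set (S → ℤ)) : Prop where
  nonneg_or_nonpos : ∀ n ∈ X, 0 ≤ n ∨ n ≤ 0
  add_single_mem : ∀ n ∈ X, ∀ i, ∀ j : ℕ, (j : ℤ) ≤ -(B.mulVec n) i →
    n + Pi.single i (j : ℤ) ∈ X
  sub_single_mem : ∀ n ∈ X, ∀ i, ∀ j : ℕ, (j : ℤ) ≤ (B.mulVec n) i →
    n - Pi.single i (j : ℤ) ∈ X
  exists_sub_single_mem : ∀ n ∈ X, 0 ≤ n → n ≠ 0 → ∃ i, n - Pi.single i 1 ∈ X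
  eq_one_of_single_mem : ∀ i, ∀ p : ℤ, 1 ≤ p → Pi.single i p ∈ X → p = 1

namespace KacMoodyAlgebra

variable {g : Type*} [LieRing g] [LieAlgebra ℂ g] {S : Type*} [Fintype S] [DecidableEq S]
  {B : Matrix S S ℤ} {K : KacMoodyAlgebra B g}

theorem isSl2Triple (hB : ∀ i, B i i = 2) (i : S) :
    IsSl2Triple (K.coroot i : g) (K.e i) (K.f i) where
  h_ne_zero h := K.indepCoroot.ne_zero i (Subtype.ext h)
  lie_e_f := by rw [K.e_f, if_pos rfl]
  lie_h_e_nsmul := by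
    rw [K.lie_e, K.pairing, hB, Int.cast_ofNat, ofNat_smul_eq_nsmul]
  lie_h_f_nsmul := by
    rw [K.lie_f, K.pairing, hB, neg_smul, Int.cast_ofNat, ofNat_smul_eq_nsmul]

variable (K) in
theorem exists_ad_e_pow_eq_zero (i : S) (x : g) : ∃ r, (LieAlgebra.ad ℂ g (K.e i) ^ r) x = 0 := by
  rw [← LieSubalgebra.mem_engel_iff]
  have hH : ∀ y : K.H, ⁅K.e i, ⁅K.e i, (y : g)⁆⁆ = 0 := fun y => by
    rw [← lie_skew (K.e i) (y : g), K.lie_e, lie_neg, lie_smul, lie_self, smul_zero, neg_zero]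
  refine K.induction_lieSpan (fun y => ?_) (fun j => ?_) (fun j => ?_) x
  · rw [LieSubalgebra.mem_engel_iff]
    exact ⟨2, by rw [pow_two]; exact hH y⟩
  · by_cases hij : i = j
    · rw [hij]; exact LieSubalgebra.self_mem_engel ℂ _
    · rw [LieSubalgebra.mem_engel_iff]
      exact ⟨_, K.serre_e i j hij⟩
  · rw [LieSubalgebra.mem_engel_iff]
    refine ⟨3, ?_⟩
    have : (LieAlgebra.ad ℂ g (K.e i) ^ 3) (K.f j) = ⁅K.e i, ⁅K.e i, ⁅K.e i, K.f j⁆⁆⁆ := by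
      simp [pow_succ]
    rw [this, K.e_f]
    split_ifs
    · exact hH _
    · simp

variable (K) in
theorem exists_ad_f_pow_eq_zero (i : S) (x : g) : ∃ r, (LieAlgebra.ad ℂ g (K.f i) ^ r) x = 0 :=
  K.opp.exists_ad_e_pow_eq_zero i x

theorem ad_e_pow_mem_wt {n : S → ℤ} {x : g} (hx : x ∈ K.wt n) (i : S) (p : ℕ) :
    (LieAlgebra.ad ℂ g (K.e i) ^ p) x ∈ K.wt (n + Pi.single i (p : ℤ)) := by
  have := ad_pow_mem_wtSpaceι hx (K.e_mem_wt i) p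
  rw [wt, ofCoord_add]
  simpa using this

theorem ad_f_pow_mem_wt {n : S → ℤ} {x : g} (hx : x ∈ K.wt n) (i : S) (p : ℕ) :
    (LieAlgebra.ad ℂ g (K.f i) ^ p) x ∈ K.wt (n - Pi.single i (p : ℤ)) := by
  have := K.opp.ad_e_pow_mem_wt (n := -n) (by rwa [opp_wt, neg_neg]) i p
  rwa [opp_wt, neg_add, neg_neg, ← sub_eq_add_neg] at this

theorem add_single_mem_weights (hB : ∀ i, B i i = 2) {n : S → ℤ} (hn : n ∈ K.weights) (i : S)
    (j : ℕ) (hj : (j : ℤ) ≤ -(B.mulVec n) i) : n + Pi.single i (j : ℤ) ∈ K.weights := by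
  obtain ⟨x, hx, hx0⟩ := Submodule.exists_mem_ne_zero_of_ne_bot hn
  obtain ⟨m, hm⟩ : ∃ m : ℕ, -(B.mulVec n) i = m := Int.eq_ofNat_of_zero_le (by omega)
  obtain ⟨p, hp⟩ := exists_ad_pow_ad_pow_ne_zero (K.isSl2Triple hB i) hx0 (m := m) (j := j)
    (by
      rw [K.lie_H_of_mem_wt hx, ofCoord_coroot]
      congr 1
      rw [eq_neg_iff_add_eq_zero, ← neg_eq_iff_add_eq_zero]
      exact_mod_cast hm) (K.exists_ad_f_pow_eq_zero i x) (by omega)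
  have := ad_e_pow_mem_wt (ad_f_pow_mem_wt hx i p) i (p + j)
  have h2 : n - Pi.single i (p : ℤ) + Pi.single i ((p + j : ℕ) : ℤ) = n + Pi.single i (j : ℤ) := by
    rw [Nat.cast_add, Pi.single_add]; abel
  rw [h2] at this
  exact (Submodule.ne_bot_iff _).2 ⟨_, this, hp⟩

theorem mem_weights_of_opp {n : S → ℤ} (h : -n ∈ K.opp.weights) : n ∈ K.weights := by
  simpa [opp_weights] using h

theorem neg_mem_opp_weights {n : S → ℤ} (h : n ∈ K.weights) : -n ∈ K.opp.weights := by
  simpa [opp_weights] using h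

theorem sub_single_mem_weights (hB : ∀ i, B i i = 2) {n : S → ℤ} (hn : n ∈ K.weights) (i : S)
    (j : ℕ) (hj : (j : ℤ) ≤ (B.mulVec n) i) : n - Pi.single i (j : ℤ) ∈ K.weights := by
  refine mem_weights_of_opp ?_
  rw [neg_sub, sub_eq_neg_add]
  exact add_single_mem_weights hB (neg_mem_opp_weights hn) i j (by simpa [Matrix.mulVec_neg] using hj)

theorem exists_sub_single_mem_weights {n : S → ℤ} (hn : n ∈ K.weights) (h0 : 0 ≤ n)
    (hn0 : n ≠ 0) : ∃ i, n - Pi.single i 1 ∈ K.weights := by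
  by_contra! h
  refine hn (eq_bot_iff.2 ((wt_le_iSup_map h0 hn0).trans (iSup_le fun i => ?_)))
  have : K.wt (n - Pi.single i 1) = ⊥ := by simpa [weights] using h i
  rw [this, Submodule.map_bot]

theorem wt_eq_bot {n : S → ℤ} {i j : S} (hi : 0 < n i) (hj : n j < 0) : K.wt n = ⊥ := by
  by_contra h
  rcases K.nonneg_or_nonpos h with h | h
  · exact absurd (h j) (not_le.2 hj)
  · exact absurd (h i) (not_le.2 hi)

theorem wt_single_one_le (i : S) : K.wt (Pi.single i 1) ≤ Submodule.span ℂ {K.e i} := by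
  refine (wt_le_iSup_map (Pi.single_nonneg.2 zero_le_one) (by simp)).trans (iSup_le fun k => ?_)
  rw [Submodule.map_le_iff_le_comap]
  by_cases hk : k = i
  · subst hk
    intro x hx
    rw [sub_self, wt_zero] at hx
    rw [Submodule.mem_comap, LieAlgebra.ad_apply, ← lie_skew, K.lie_e ⟨x, hx⟩]
    exact neg_mem (Submodule.smul_mem _ _ (Submodule.mem_span_singleton_self _))
  · rw [wt_eq_bot (i := i) (j := k)]
    · exact bot_le
    · simp [Pi.single_eq_of_ne (Ne.symm hk)]
    · simp [Pi.single_eq_of_ne hk]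

theorem wt_single_eq_bot (i : S) (q : ℕ) : K.wt (Pi.single i ((q : ℤ) + 2)) = ⊥ := by
  induction q with
  | zero =>
    refine eq_bot_iff.2 ((wt_le_iSup_map (Pi.single_nonneg.2 (by positivity)) ?_).trans
      (iSup_le fun k => ?_))
    · simp
    rw [Submodule.map_le_iff_le_comap]
    by_cases hk : k = i
    · subst hk
      rw [← Pi.single_sub]
      intro x hx
      obtain ⟨c, rfl⟩ := Submodule.mem_span_singleton.1 (wt_single_one_le k hx)
      simp
    · rw [wt_eq_bot (i := i) (j := k)]
      · exact bot_le
      · simp [Pi.single_eq_of_ne (Ne.symm hk)]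
      · simp [Pi.single_eq_of_ne hk]
  | succ q ih =>
    by_contra h
    obtain ⟨k, hk⟩ := exists_sub_single_mem_weights h (Pi.single_nonneg.2 (by positivity)) (by
      simp; omega)
    by_cases hki : k = i
    · subst hki
      rw [← Pi.single_sub] at hk
      have h2 : ((q + 1 : ℕ) : ℤ) + 2 - 1 = (q : ℤ) + 2 := by push_cast; ring
      rw [h2] at hk
      exact hk ih
    · refine hk (wt_eq_bot (i := i) (j := k) ?_ ?_)
      · simp [Pi.single_eq_of_ne (Ne.symm hki)]; omega
      · simp [Pi.single_eq_of_ne hki]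

variable (K) in
theorem isRootLike_weights (hB : ∀ i, B i i = 2) : IsRootLike B K.weights where
  nonneg_or_nonpos _ := K.nonneg_or_nonpos
  add_single_mem _ := add_single_mem_weights hB
  sub_single_mem _ := sub_single_mem_weights hB
  exists_sub_single_mem _ := exists_sub_single_mem_weights
  eq_one_of_single_mem i p hp h := by
    by_contra h1
    obtain ⟨q, hq⟩ : ∃ q : ℕ, p - 2 = q := Int.eq_ofNat_of_zero_le (by omega)
    obtain rfl : p = q + 2 := by omega
    exact h (wt_single_eq_bot i q)

theorem finiteDimensional_wt_of_sum_eq (q : ℕ) : ∀ n : S → ℤ, ∑ i, n i = q →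
    FiniteDimensional ℂ (K.wt n) := by
  induction q with
  | zero =>
    intro n hn
    by_cases h0 : n = 0
    · rw [h0, wt_zero]; exact K.findimH
    by_cases hw : n ∈ K.weights
    · refine absurd ?_ h0
      rcases K.nonneg_or_nonpos hw with h | h
      · ext i
        exact (Finset.sum_eq_zero_iff_of_nonneg (fun i _ => h i)).1 (by simpa using hn) i
          (Finset.mem_univ i)
      · ext i
        exact (Finset.sum_eq_zero_iff_of_nonpos (fun i _ => h i)).1 (by simpa using hn) i
          (Finset.mem_univ i)
    · have : K.wt n = ⊥ := by simpa [weights] using hw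
      rw [this]; infer_instance
  | succ q ih =>
    intro n hn
    by_cases hw : n ∈ K.weights
    · have h0 : 0 ≤ n := by
        refine (K.nonneg_or_nonpos hw).resolve_right fun h => ?_
        have := Finset.sum_nonpos (s := Finset.univ) fun i _ => h i
        rw [hn] at this
        omega
      have h1 : n ≠ 0 := by rintro rfl; simp at hn; omega
      have : ∀ i, FiniteDimensional ℂ (K.wt (n - Pi.single i 1)) := fun i => ih _ (by
        simp [Finset.sum_sub_distrib, hn])
      exact Submodule.finiteDimensional_of_le (wt_le_iSup_map h0 h1)
    · have : K.wt n = ⊥ := by simpa [weights] using hw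
      rw [this]; infer_instance

variable (K) in
theorem finiteDimensional_wt (n : S → ℤ) : FiniteDimensional ℂ (K.wt n) := by
  rcases Int.le_total 0 (∑ i, n i) with h | h
  · obtain ⟨q, hq⟩ := Int.eq_ofNat_of_zero_le h
    exact finiteDimensional_wt_of_sum_eq q n hq
  · obtain ⟨q, hq⟩ := Int.eq_ofNat_of_zero_le (neg_nonneg.2 h)
    have := finiteDimensional_wt_of_sum_eq (K := K.opp) q (-n) (by simpa using hq)
    rwa [opp_wt, neg_neg] at this

theorem wt_le_gS_of_sum_eq {P : Set S} (q : ℕ) : ∀ n : S → ℤ, 0 ≤ n → (∀ i, n i ≠ 0 → i ∈ P) →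
    ∑ i, n i = (q : ℤ) + 1 → K.wt n ≤ (gS K P).toSubmodule := by
  induction q with
  | zero =>
    intro n h0 hP hn
    have hn0 : n ≠ 0 := by rintro rfl; simp at hn
    obtain ⟨i, hi⟩ := Function.ne_iff.1 hn0
    have hi' : 0 < n i := lt_of_le_of_ne (h0 i) (Ne.symm hi)
    have h1 : n i + ∑ j ∈ Finset.univ.erase i, n j = 1 := by
      rw [Finset.add_sum_erase _ _ (Finset.mem_univ i)]; simpa using hn
    have h2 : 0 ≤ ∑ j ∈ Finset.univ.erase i, n j := Finset.sum_nonneg fun j _ => h0 j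
    have h3 : ∑ j ∈ Finset.univ.erase i, n j = 0 := by omega
    have : n = Pi.single i 1 := by
      ext j
      by_cases hj : j = i
      · subst hj; rw [Pi.single_eq_same]; omega
      · rw [Pi.single_eq_of_ne hj]
        exact (Finset.sum_eq_zero_iff_of_nonneg (fun i _ => h0 i)).1 h3 j (by simp [hj])
    rw [this]
    refine (wt_single_one_le i).trans ?_
    rw [Submodule.span_singleton_le_iff_mem]
    exact LieSubalgebra.subset_lieSpan (Or.inl ⟨i, hP i hi, rfl⟩)
  | succ q ih =>
    intro n h0 hP hn
    have h1 : n ≠ 0 := by rintro rfl; simp at hn; omega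
    refine (wt_le_iSup_map h0 h1).trans (iSup_le fun i => ?_)
    by_cases hi : n i = 0
    · have : K.wt (n - Pi.single i 1) = ⊥ := by
        by_contra hw
        rcases K.nonneg_or_nonpos hw with h | h
        · have := h i
          simp [hi] at this
        · have := Finset.sum_nonpos (s := Finset.univ) fun i _ => h i
          simp [Finset.sum_sub_distrib, hn] at this
          omega
      rw [this, Submodule.map_bot]; exact bot_le
    · rw [Submodule.map_le_iff_le_comap]
      intro x hx
      refine (gS K P).lie_mem (LieSubalgebra.subset_lieSpan (Or.inl ⟨i, hP i hi, rfl⟩)) ?_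
      refine ih (n - Pi.single i 1) (fun j => ?_) (fun j hj => hP j fun hj0 => hj ?_) ?_ hx
      · by_cases hj : j = i
        · subst hj
          have := h0 j
          simp at this ⊢; omega
        · simpa [Pi.single_eq_of_ne hj] using h0 j
      · have : j ≠ i := by rintro rfl; exact hi hj0
        simp [Pi.single_eq_of_ne this, hj0]
      · simp [Finset.sum_sub_distrib, hn]

theorem wt_le_gS {P : Set S} {n : S → ℤ} (h0 : 0 ≤ n) (hn0 : n ≠ 0) (hP : ∀ i, n i ≠ 0 → i ∈ P) :
    K.wt n ≤ (gS K P).toSubmodule := by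
  obtain ⟨i, hi⟩ := Function.ne_iff.1 hn0
  have h1 : n i ≤ ∑ i, n i := Finset.single_le_sum (fun j _ => h0 j) (Finset.mem_univ i)
  have h2 : 0 < n i := lt_of_le_of_ne (h0 i) (Ne.symm hi)
  obtain ⟨q, hq⟩ := Int.eq_ofNat_of_zero_le (a := ∑ i, n i - 1) (by omega)
  exact wt_le_gS_of_sum_eq q n h0 hP (by omega)

end KacMoodyAlgebra

section Combinatorics

theorem exists_pos_symmetrizer {I : Type*} {A : Matrix I I ℤ} (hGCM : IsGCM A)
    (hInd : Indecomposable A) (hSym : Symmetrizable A) :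
    ∃ d : I → ℝ, (∀ i, 0 < d i) ∧ ∀ i j, d i * (A i j : ℝ) = d j * (A j i : ℝ) := by
  obtain ⟨d, hd0, hd⟩ := hSym
  have hd' : ∀ i j, (d i : ℝ) * (A i j : ℝ) = d j * (A j i : ℝ) := fun i j => by
    exact_mod_cast hd i j
  by_cases h1 : {i | 0 < d i}.Nonempty
  · by_cases h2 : {i | 0 < d i}ᶜ.Nonempty
    · obtain ⟨i, hi, j, hj, hij⟩ := hInd _ h1 h2
      exfalso
      have hne : i ≠ j := by rintro rfl; exact hj hi
      have h3 : A i j < 0 := lt_of_le_of_ne (hGCM.2.1 i j hne) hij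
      have h4 : A j i < 0 := lt_of_le_of_ne (hGCM.2.1 j i hne.symm)
        (fun h => hij (hGCM.2.2 j i h))
      have h5 : d j < 0 := lt_of_le_of_ne (not_lt.1 hj) (hd0 j)
      have h6 : d i * (A i j : ℚ) < 0 := mul_neg_of_pos_of_neg hi (by exact_mod_cast h3)
      have h7 : 0 < d j * (A j i : ℚ) := mul_pos_of_neg_of_neg h5 (by exact_mod_cast h4)
      rw [hd] at h6
      exact lt_asymm h6 h7
    · rw [Set.not_nonempty_iff_eq_empty, Set.compl_empty_iff, Set.eq_univ_iff_forall] at h2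
      exact ⟨fun i => d i, fun i => Rat.cast_pos.2 (h2 i), hd'⟩
  · rw [Set.not_nonempty_iff_eq_empty, Set.eq_empty_iff_forall_notMem] at h1
    refine ⟨fun i => -d i, fun i => ?_, fun i j => ?_⟩
    · have : d i < 0 := lt_of_le_of_ne (not_lt.1 (h1 i)) (hd0 i)
      exact neg_pos.2 (by exact_mod_cast this)
    · rw [neg_mul, neg_mul, hd' i j]

variable {S : Type*} [Fintype S] [DecidableEq S] {B : Matrix S S ℤ}

omit [DecidableEq S] in
theorem IsFiniteType.exists_pos {P : Set S} (h : IsFiniteType (restrictM B P)) :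
    ∃ u : S → ℝ, (∀ i ∈ P, 0 < u i) ∧ (∀ i ∉ P, u i = 0) ∧
      ∀ i ∈ P, 0 < ∑ j, (B i j : ℝ) * u j := by
  classical
  obtain ⟨u, hu, hBu⟩ := h
  refine ⟨fun i => if h : i ∈ P then (u ⟨i, h⟩ : ℝ) else 0, fun i hi => ?_, fun i hi => ?_,
    fun i hi => ?_⟩
  · simpa [hi] using hu ⟨i, hi⟩
  · simp [hi]
  · have h1 := hBu ⟨i, hi⟩
    rw [finsum_eq_sum_of_fintype] at h1
    have h2 : (0 : ℝ) < ∑ j : P, (B i j : ℝ) * (u j : ℝ) := by exact_mod_cast h1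
    set F : S → ℝ := fun j => (B i j : ℝ) * (if h : j ∈ P then (u ⟨j, h⟩ : ℝ) else 0) with hF
    have h3 : ∑ j, F j = ∑ j : P, (B i j : ℝ) * (u j : ℝ) := by
      rw [← Finset.sum_subset (Finset.subset_univ P.toFinset)
        (fun j _ hj => by simp [hF, Set.mem_toFinset.not.1 hj]), ← Finset.sum_set_coe]
      exact Finset.sum_congr rfl fun j _ => by simp [hF]
    exact h3 ▸ h2

omit [DecidableEq S] in
theorem sum_symmetrized {d : S → ℝ} (hd : ∀ i j, d i * (B i j : ℝ) = d j * (B j i : ℝ))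
    (x y : S → ℝ) :
    ∑ i, d i * x i * ∑ j, (B i j : ℝ) * y j = ∑ i, d i * y i * ∑ j, (B i j : ℝ) * x j := by
  simp only [Finset.mul_sum]
  rw [Finset.sum_comm]
  refine Finset.sum_congr rfl fun i _ => Finset.sum_congr rfl fun j _ => ?_
  linear_combination (x j * y i) * hd j i

theorem mulVec_sub_single (n : S → ℤ) (i : S) (m : ℤ) (j : S) :
    (B.mulVec (n - Pi.single i m)) j = B.mulVec n j - B j i * m := by
  rw [Matrix.mulVec_sub, Pi.sub_apply, Matrix.mulVec_single]
  simp [mul_comm]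

omit [Fintype S] in
theorem eq_single_of_sub_single_nonpos {n : S → ℤ} (hn : 0 ≤ n) {k : S} {m : ℤ}
    (h : n - Pi.single k m ≤ 0) : n = Pi.single k (n k) := by
  ext i
  by_cases hi : i = k
  · subst hi; simp
  · rw [Pi.single_eq_of_ne hi]
    have := h i
    simp [Pi.single_eq_of_ne hi] at this
    exact le_antisymm this (hn i)

/-- Real-valued quadratic form attached to a symmetrizer. -/
def quadForm (B : Matrix S S ℤ) (d : S → ℝ) (n : S → ℤ) : ℝ :=
  ∑ i, d i * n i * (B.mulVec n i : ℤ)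

omit [DecidableEq S] in
theorem cast_mulVec (n : S → ℤ) (i : S) :
    ((B.mulVec n i : ℤ) : ℝ) = ∑ j, (B i j : ℝ) * (n j : ℝ) := by
  simp [Matrix.mulVec, dotProduct]

omit [DecidableEq S] in
theorem quadForm_add {d : S → ℝ} (hd : ∀ i j, d i * (B i j : ℝ) = d j * (B j i : ℝ))
    (n m : S → ℤ) : quadForm B d (n + m) =
      quadForm B d n + 2 * ∑ i, d i * m i * (B.mulVec n i : ℤ) + quadForm B d m := by
  have h := sum_symmetrized hd (fun i => (n i : ℝ)) (fun i => (m i : ℝ))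
  simp only [← cast_mulVec] at h
  unfold quadForm
  simp only [Matrix.mulVec_add, Pi.add_apply, Int.cast_add, mul_add, add_mul,
    Finset.sum_add_distrib]
  rw [h]
  ring

theorem quadForm_sub_single (hB : ∀ i, B i i = 2) {d : S → ℝ}
    (hd : ∀ i j, d i * (B i j : ℝ) = d j * (B j i : ℝ)) (n : S → ℤ) (j : S) :
    quadForm B d (n - Pi.single j (B.mulVec n j)) = quadForm B d n := by
  have h1 : ∀ (m : ℤ) (y : S → ℤ), ∑ i, d i * ((Pi.single j m : S → ℤ) i : ℝ) * (y i : ℝ) =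
      d j * m * y j := fun m y => by
    rw [Finset.sum_eq_single j (fun i _ hi => by simp [Pi.single_eq_of_ne hi]) (by simp)]
    simp
  rw [sub_eq_add_neg, ← Pi.single_neg, quadForm_add hd, h1]
  unfold quadForm
  rw [h1, Matrix.mulVec_single]
  simp [hB]
  ring

theorem quadForm_single (hB : ∀ i, B i i = 2) {d : S → ℝ} (j : S) :
    quadForm B d (Pi.single j 1) = 2 * d j := by
  unfold quadForm
  rw [Finset.sum_eq_single j (fun i _ hi => by simp [Pi.single_eq_of_ne hi]) (by simp)]
  simp [hB, mul_comm]

theorem IsRootLike.quadForm_le {X : Set (S → ℤ)} (hX : IsRootLike B X) (hB : IsGCM B) {d : S → ℝ}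
    (hd0 : ∀ i, 0 < d i) (hd : ∀ i j, d i * (B i j : ℝ) = d j * (B j i : ℝ)) (P : Set S)
    (c : S → ℤ) (hc : ∀ i ∈ P, c i = 0) (N : ℕ) : ∀ n ∈ X, 0 ≤ n → (∀ i ∉ P, n i = c i) →
    ∑ i, n i = N → quadForm B d n ≤ |quadForm B d c| + ∑ i, 2 * d i := by
  induction N using Nat.strong_induction_on with
  | _ N ih =>
  intro n hn h0 hnc hN
  have hs : ∀ j, 2 * d j ≤ ∑ i, 2 * d i := fun j =>
    Finset.single_le_sum (f := fun i => 2 * d i) (fun i _ => by have := hd0 i; positivity)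
      (Finset.mem_univ j)
  have hs0 : 0 ≤ ∑ i, 2 * d i := Finset.sum_nonneg fun i _ => by have := hd0 i; positivity
  by_cases h : ∀ j ∈ P, B.mulVec n j ≤ 0
  · have : quadForm B d n ≤ quadForm B d c := by
      unfold quadForm
      refine Finset.sum_le_sum fun i _ => ?_
      by_cases hi : i ∈ P
      · rw [hc i hi]
        have h1 : (B.mulVec n i : ℝ) ≤ 0 := by exact_mod_cast h i hi
        have h2 : (0 : ℝ) ≤ n i := by exact_mod_cast h0 i
        have h3 := hd0 i
        simpa using mul_nonpos_of_nonneg_of_nonpos (mul_nonneg h3.le h2) h1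
      · rw [hnc i hi]
        have h2 : (0 : ℝ) ≤ c i := by rw [← hnc i hi]; exact_mod_cast h0 i
        refine mul_le_mul_of_nonneg_left ?_ (mul_nonneg (hd0 i).le h2)
        norm_cast
        refine Finset.sum_le_sum fun j _ => ?_
        by_cases hj : j ∈ P
        · rw [hc j hj, mul_zero]
          exact mul_nonpos_of_nonpos_of_nonneg (hB.2.1 i j (by rintro rfl; exact hi hj)) (h0 j)
        · rw [hnc j hj]
    exact this.trans ((le_abs_self _).trans (by linarith))
  · push Not at h
    obtain ⟨j, hj, hpos⟩ := h
    obtain ⟨m, hm⟩ := Int.eq_ofNat_of_zero_le hpos.le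
    have h1 : n - Pi.single j (B.mulVec n j) ∈ X := by
      have := hX.sub_single_mem n hn j m (by omega)
      rwa [← hm] at this
    rcases hX.nonneg_or_nonpos _ h1 with h2 | h2
    · rw [← quadForm_sub_single hB.1 hd n j]
      have h3 : ∑ i, (n - Pi.single j (B.mulVec n j) : S → ℤ) i = N - B.mulVec n j := by
        simp [Finset.sum_sub_distrib, hN]
      have h4 : 0 ≤ ∑ i, (n - Pi.single j (B.mulVec n j) : S → ℤ) i :=
        Finset.sum_nonneg fun i _ => h2 i
      refine ih (N - m) (by omega) _ h1 h2 (fun i hi => ?_) (by omega)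
      have : i ≠ j := by rintro rfl; exact hi hj
      simp [Pi.single_eq_of_ne this, hnc i hi]
    · have h3 := eq_single_of_sub_single_nonpos h0 h2
      have h4 : 1 ≤ n j := by
        by_contra h5
        have h6 : n j = 0 := le_antisymm (by omega) (h0 j)
        rw [h6, Pi.single_zero] at h3
        rw [h3, Matrix.mulVec_zero] at hpos
        exact lt_irrefl _ hpos
      rw [h3, hX.eq_one_of_single_mem j _ h4 (h3 ▸ hn), quadForm_single hB.1]
      exact (hs j).trans (by linarith [abs_nonneg (quadForm B d c)])

/-- The quadratic form is positive definite on finite type subsets. -/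
theorem sum_le_quadForm (hB : IsGCM B) {d : S → ℝ} (hd0 : ∀ i, 0 < d i)
    (hd : ∀ i j, d i * (B i j : ℝ) = d j * (B j i : ℝ)) {P : Set S} {u : S → ℝ}
    (hu : ∀ i ∈ P, 0 < u i) (hu0 : ∀ i ∉ P, u i = 0) (b : S → ℤ) (hb : ∀ i ∉ P, b i = 0) :
    ∑ i, d i * (∑ j, (B i j : ℝ) * u j) / u i * (b i : ℝ) ^ 2 ≤ quadForm B d b := by
  have key : ∀ i j, d i * (B i j * u j) / u i * (b i : ℝ) ^ 2 +
      d j * (B j i * u i) / u j * (b j : ℝ) ^ 2 ≤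
      d i * b i * (B i j * b j) + d j * b j * (B j i * b i) := fun i j => by
    by_cases hi : i ∈ P
    · by_cases hj : j ∈ P
      · have h1 := hu i hi
        have h2 := hu j hj
        by_cases hij : i = j
        · subst hij
          apply le_of_eq
          field_simp
        · have h3 : d i * (B i j : ℝ) ≤ 0 := mul_nonpos_of_nonneg_of_nonpos (hd0 i).le
            (by exact_mod_cast hB.2.1 i j hij)
          have h4 : d i * b i * (B i j * b j) + d j * b j * (B j i * b i) -
              (d i * (B i j * u j) / u i * (b i : ℝ) ^ 2 +
                d j * (B j i * u i) / u j * (b j : ℝ) ^ 2) =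
              -(d i * (B i j : ℝ)) * ((u j * b i - u i * b j) ^ 2 / (u i * u j)) := by
            field_simp
            linear_combination (2 * u i * u j * b i * b j - 2 * u i ^ 2 * b j ^ 2) / 2 * hd j i
          have h5 : 0 ≤ -(d i * (B i j : ℝ)) * ((u j * b i - u i * b j) ^ 2 / (u i * u j)) :=
            mul_nonneg (by linarith) (by positivity)
          linarith
      · simp [hb j hj, hu0 j hj]
    · simp [hb i hi, hu0 i hi]
  have h1 : ∑ i, d i * (∑ j, (B i j : ℝ) * u j) / u i * (b i : ℝ) ^ 2 =
      ∑ i, ∑ j, d i * (B i j * u j) / u i * (b i : ℝ) ^ 2 := by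
    simp only [Finset.mul_sum, Finset.sum_div, Finset.sum_mul]
  have h2 : quadForm B d b = ∑ i, ∑ j, d i * b i * (B i j * b j : ℝ) := by
    simp only [quadForm, cast_mulVec, Finset.mul_sum]
  have h3 := Finset.sum_le_sum fun i (_ : i ∈ Finset.univ) =>
    Finset.sum_le_sum fun j (_ : j ∈ Finset.univ) => key i j
  simp only [Finset.sum_add_distrib] at h3
  rw [Finset.sum_comm (f := fun i j => d j * (B j i * u i) / u j * (b j : ℝ) ^ 2),
    Finset.sum_comm (f := fun i j => d j * b j * (B j i * b i : ℝ))] at h3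
  rw [h1, h2]
  linarith

theorem IsRootLike.finite_nonneg {X : Set (S → ℤ)} (hX : IsRootLike B X) (hB : IsGCM B) {d : S → ℝ}
    (hd0 : ∀ i, 0 < d i) (hd : ∀ i j, d i * (B i j : ℝ) = d j * (B j i : ℝ)) {P : Set S}
    (hP : IsFiniteType (restrictM B P)) (n₀ : S → ℤ) :
    {n ∈ X | 0 ≤ n ∧ ∀ i ∉ P, n i = n₀ i}.Finite := by
  classical
  obtain ⟨u, hu, hu0, hBu⟩ := hP.exists_pos
  set c : S → ℤ := fun i => if i ∈ P then 0 else n₀ i with hc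
  set κ : S → ℝ := fun i => d i * (∑ j, (B i j : ℝ) * u j) / u i with hκ
  set t : S → ℝ := fun i => d i * (B.mulVec c i : ℤ) with ht
  have hκ0 : ∀ i ∈ P, 0 < κ i := fun i hi =>
    div_pos (mul_pos (hd0 i) (hBu i hi)) (hu i hi)
  set C := |quadForm B d c| + ∑ i, 2 * d i - quadForm B d c + ∑ i, t i ^ 2 / κ i with hC
  have main : ∀ n ∈ X, 0 ≤ n → (∀ i ∉ P, n i = n₀ i) → ∀ i ∈ P,
      (n i : ℝ) ≤ (C + 2 * t i ^ 2 / κ i) * 2 / κ i := by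
    intro n hn h0 hn0 i hi
    obtain ⟨N, hN⟩ := Int.eq_ofNat_of_zero_le (Finset.sum_nonneg fun i _ => h0 i)
    have h1 := hX.quadForm_le hB hd0 hd P c (fun i hi => by simp [hc, hi]) N n hn h0
      (fun i hi => by simp [hc, hi, hn0 i hi]) hN
    set b : S → ℤ := fun i => if i ∈ P then n i else 0 with hb
    have hcb : n = c + b := by
      ext j
      by_cases hj : j ∈ P
      · simp [hc, hb, hj]
      · simp [hc, hb, hj, hn0 j hj]
    have h2 := sum_le_quadForm hB hd0 hd hu hu0 b (fun i hi => by simp [hb, hi])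
    rw [hcb, quadForm_add hd] at h1
    have h3 : ∑ j, (κ j * (b j : ℝ) ^ 2 + 2 * t j * b j + t j ^ 2 / κ j) ≤ C := by
      simp only [Finset.sum_add_distrib]
      have : ∑ j, 2 * t j * b j = 2 * ∑ i, d i * b i * (B.mulVec c i : ℤ) := by
        rw [Finset.mul_sum]
        exact Finset.sum_congr rfl fun j _ => by simp only [ht]; ring
      rw [this]
      linarith
    have h4 : ∀ j, 0 ≤ κ j * (b j : ℝ) ^ 2 + 2 * t j * b j + t j ^ 2 / κ j := fun j => by
      by_cases hj : j ∈ P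
      · have := hκ0 j hj
        have h5 : κ j * (b j : ℝ) ^ 2 + 2 * t j * b j + t j ^ 2 / κ j =
          (κ j * b j + t j) ^ 2 / κ j := by field_simp; ring
        rw [h5]; positivity
      · have : κ j = 0 := by simp [hκ, hu0 j hj]
        simp [this, hb, hj]
    have h5 := (Finset.single_le_sum (fun j _ => h4 j) (Finset.mem_univ i)).trans h3
    have h6 := hκ0 i hi
    have hbi : b i = n i := by simp [hb, hi]
    rw [hbi] at h5
    have h7 : (n i : ℝ) ≤ (n i : ℝ) ^ 2 := by
      have : n i ≤ n i ^ 2 := Int.le_self_sq _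
      exact_mod_cast this
    have h8 : κ i / 2 * (n i : ℝ) ^ 2 ≤ C + 2 * t i ^ 2 / κ i := by
      have h9 : 0 ≤ (κ i * n i + 2 * t i) ^ 2 / (2 * κ i) := by positivity
      have h10 : (κ i * n i + 2 * t i) ^ 2 / (2 * κ i) =
        κ i / 2 * (n i : ℝ) ^ 2 + 2 * t i * n i + 2 * t i ^ 2 / κ i := by field_simp; ring
      have h11 : 0 ≤ t i ^ 2 / κ i := by positivity
      linarith
    refine h7.trans ?_
    rw [le_div_iff₀ h6]
    linarith
  refine (Set.finite_Icc (0 : S → ℤ) (fun i => if i ∈ P then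
    ⌊(C + 2 * t i ^ 2 / κ i) * 2 / κ i⌋ else n₀ i)).subset ?_
  rintro n ⟨hn, h0, hn0⟩
  refine ⟨h0, fun i => ?_⟩
  by_cases hi : i ∈ P
  · simp only [hi, if_true]
    exact Int.le_floor.2 (main n hn h0 hn0 i hi)
  · simp [hi, hn0 i hi]

theorem finite_of_isRootLike {X : Set (S → ℤ)} (hX : IsRootLike B X) (hX' : IsRootLike B (-X))
    (hB : IsGCM B) {d : S → ℝ} (hd0 : ∀ i, 0 < d i)
    (hd : ∀ i j, d i * (B i j : ℝ) = d j * (B j i : ℝ)) {P : Set S}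
    (hP : IsFiniteType (restrictM B P)) (n₀ : S → ℤ) :
    {n ∈ X | ∀ i ∉ P, n i = n₀ i}.Finite := by
  refine ((hX.finite_nonneg hB hd0 hd hP n₀).union
    (hX'.finite_nonneg hB hd0 hd hP (-n₀)).neg).subset ?_
  rintro n ⟨hn, hn0⟩
  rcases hX.nonneg_or_nonpos n hn with h | h
  · exact Or.inl ⟨hn, h, hn0⟩
  · exact Or.inr ⟨by simpa using hn, neg_nonneg.2 h, fun i hi => by simp [hn0 i hi]⟩

end Combinatorics

section Connected

variable {S : Type*} [Fintype S] [DecidableEq S] {B : Matrix S S ℤ}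

/-- The support of each nonnegative element of `X` is connected in the Dynkin diagram of `B`. -/
def HasConnectedSupports (B : Matrix S S ℤ) (X : Set (S → ℤ)) : Prop :=
  ∀ n ∈ X, 0 ≤ n → ∀ P : Set S, (∀ i ∈ P, ∀ j ∉ P, n i ≠ 0 → n j ≠ 0 → B i j = 0) →
    (∀ i, n i ≠ 0 → i ∈ P) ∨ ∀ i ∈ P, n i = 0

theorem IsRootLike.sub_single_not_mem {X : Set (S → ℤ)} (hX : IsRootLike B X)
    (hB : ∀ i, B i i = 2) {n : S → ℤ} {i : S} (h0 : 0 ≤ n - Pi.single i 1)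
    (hne : n - Pi.single i 1 ≠ 0) (hi : n i = 1) (hBn : B.mulVec (n - Pi.single i 1) i = 0) :
    n ∉ X := by
  intro hn
  rw [mulVec_sub_single, hB] at hBn
  have h1 := hX.sub_single_mem n hn i 2 (by push_cast; omega)
  obtain ⟨j, hj⟩ := Function.ne_iff.1 hne
  have hji : j ≠ i := by rintro rfl; simp [hi] at hj
  rcases hX.nonneg_or_nonpos _ h1 with h | h
  · have := h i
    simp [hi] at this
  · have h2 := h j
    have h3 := h0 j
    simp [Pi.single_eq_of_ne hji] at h2 h3 hj
    omega

theorem IsRootLike.hasConnectedSupports {X : Set (S → ℤ)} (hX : IsRootLike B X) (hB : IsGCM B) :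
    HasConnectedSupports B X := by
  intro n hn h0
  obtain ⟨N, hN⟩ := Int.eq_ofNat_of_zero_le (Finset.sum_nonneg fun i (_ : i ∈ Finset.univ) => h0 i)
  induction N generalizing n with
  | zero =>
    intro P _
    exact Or.inr fun i _ => (Finset.sum_eq_zero_iff_of_nonneg (fun i _ => h0 i)).1
      (by simpa using hN) i (Finset.mem_univ i)
  | succ N ih =>
    intro P hP
    obtain ⟨i, hi⟩ := hX.exists_sub_single_mem n hn h0 (by rintro rfl; simp at hN; omega)
    rcases hX.nonneg_or_nonpos _ hi with h | h
    · by_cases hne : n - Pi.single i 1 = 0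
      · rw [sub_eq_zero.1 hne]
        by_cases hiP : i ∈ P
        · exact Or.inl fun j hj => by
            by_cases hji : j = i
            · exact hji ▸ hiP
            · simp [Pi.single_eq_of_ne hji] at hj
        · exact Or.inr fun j hj => Pi.single_eq_of_ne (by rintro rfl; exact hiP hj) _
      have hsupp : ∀ j, (n - Pi.single i 1 : S → ℤ) j ≠ 0 → n j ≠ 0 := fun j hj hj0 => by
        have := h j
        by_cases hji : j = i
        · subst hji; simp [hj0] at this
        · simp [Pi.single_eq_of_ne hji, hj0] at hj
      have hni : n i ≠ 0 := fun h1 => by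
        have := h i
        simp [h1] at this
      have hne_of : ∀ j, j ≠ i → (n - Pi.single i 1 : S → ℤ) j = n j := fun j hj => by
        simp [Pi.single_eq_of_ne hj]
      have hcase := ih (n - Pi.single i 1) hi h (by simp [Finset.sum_sub_distrib, hN]) P
        (fun a ha b hb h1 h2 => hP a ha b hb (hsupp a h1) (hsupp b h2))
      have hkey : (n - Pi.single i 1 : S → ℤ) i = 0 →
          (∀ j, (n - Pi.single i 1 : S → ℤ) j ≠ 0 → B i j = 0) → False := fun h1 h2 => by
        refine hX.sub_single_not_mem hB.1 h hne (i := i) ?_ ?_ hn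
        · simp at h1; omega
        · refine Finset.sum_eq_zero fun j _ => ?_
          by_cases hj : (n - Pi.single i 1 : S → ℤ) j = 0
          · rw [hj, mul_zero]
          · exact mul_eq_zero_of_left (h2 j hj) _
      rcases hcase with h1 | h1
      · left
        have hiP : i ∈ P := by
          by_contra hiP
          refine hkey (by_contra fun h2 => hiP (h1 i h2)) fun j hj => ?_
          exact hB.2.2 _ _ (hP j (h1 j hj) i hiP (hsupp j hj) hni)
        intro j hj
        by_cases hji : j = i
        · exact hji ▸ hiP
        · exact h1 j (by rwa [hne_of j hji])
      · right
        have hiP : i ∉ P := fun hiP => hkey (h1 i hiP) fun j hj =>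
          hP i hiP j (fun hjP => hj (h1 j hjP)) hni (hsupp j hj)
        intro j hj
        rw [← h1 j hj, hne_of j (by rintro rfl; exact hiP hj)]
    · have h3 := eq_single_of_sub_single_nonpos h0 h
      by_cases hiP : i ∈ P
      · left
        intro j hj
        by_cases hji : j = i
        · exact hji ▸ hiP
        · rw [h3, Pi.single_eq_of_ne hji] at hj
          exact absurd rfl hj
      · right
        intro j hj
        rw [h3, Pi.single_eq_of_ne (by rintro rfl; exact hiP hj)]

/-- A maximal element of a set of roots below `n`, for an element `n` of the antidominant
cone with connected support, is `n` itself. -/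
theorem IsRootLike.mem_of_antidominant {Ψ : Set (S → ℤ)} (hΨ : IsRootLike B Ψ) (hB : IsGCM B)
    {d : S → ℝ} (hd0 : ∀ i, 0 < d i) (hd : ∀ i j, d i * (B i j : ℝ) = d j * (B j i : ℝ))
    (hΨ1 : ∀ i, Pi.single i 1 ∈ Ψ) {n : S → ℤ} (h0 : 0 ≤ n) (hn0 : n ≠ 0)
    (hn : ∀ i, B.mulVec n i ≤ 0)
    (hconn : ∀ P : Set S, (∀ i ∈ P, ∀ j ∉ P, n i ≠ 0 → n j ≠ 0 → B i j = 0) →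
      (∀ i, n i ≠ 0 → i ∈ P) ∨ ∀ i ∈ P, n i = 0) : n ∈ Ψ := by
  obtain ⟨k, hk⟩ := Function.ne_iff.1 hn0
  have hk1 : 0 < n k := lt_of_le_of_ne (h0 k) (Ne.symm hk)
  have hfin : {β ∈ Ψ | 0 ≤ β ∧ β ≤ n ∧ β ≠ 0}.Finite :=
    (Set.finite_Icc (0 : S → ℤ) n).subset fun β hβ => ⟨hβ.2.1, hβ.2.2.1⟩
  obtain ⟨β, ⟨hβ, hβ0, hβn, hβne⟩, hmax⟩ := Set.exists_max_image _ (fun β => ∑ i, β i) hfin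
    ⟨Pi.single k 1, hΨ1 k, Pi.single_nonneg.2 zero_le_one, fun i => by
      by_cases hik : i = k
      · subst hik; simpa using Int.add_one_le_iff.2 hk1
      · simpa [Pi.single_eq_of_ne hik] using h0 i, by simp⟩
  have hadd : ∀ i, β i < n i → β + Pi.single i 1 ∉ Ψ := fun i hi h => by
    have := hmax (β + Pi.single i 1) ⟨h, add_nonneg hβ0 (Pi.single_nonneg.2 zero_le_one),
      fun j => by
        by_cases hji : j = i
        · subst hji; simpa using hi
        · simpa [Pi.single_eq_of_ne hji] using hβn j, fun h1 => by
        have h2 := congrFun h1 i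
        have h3 := hβ0 i
        simp at h2 h3
        omega⟩
    simp [Finset.sum_add_distrib] at this
  by_cases hβeq : β = n
  · exact hβeq ▸ hβ
  exfalso
  set T : Set S := {i | β i < n i} with hT
  have hTeq : ∀ i ∉ T, β i = n i := fun i hi => le_antisymm (hβn i) (not_lt.1 hi)
  have hpair : ∀ i ∈ T, 0 ≤ B.mulVec β i := fun i hi => by
    by_contra h
    exact hadd i hi (by simpa using hΨ.add_single_mem β hβ i 1 (by push_cast; omega))
  set b : S → ℤ := fun i => if i ∈ T then β i else 0 with hb
  have hbo : ∀ i ∈ T, B.mulVec β i = B.mulVec b i + ∑ j, B i j * (if j ∈ T then 0 else β j) :=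
    fun i _ => by
      simp only [Matrix.mulVec, dotProduct]
      rw [← Finset.sum_add_distrib]
      refine Finset.sum_congr rfl fun j _ => ?_
      by_cases hj : j ∈ T <;> simp [hb, hj]
  have hterm : ∀ i ∈ T, ∀ j, B i j * (if j ∈ T then 0 else β j) ≤ 0 := fun i hi j => by
    by_cases hj : j ∈ T
    · simp [hj]
    · simp only [hj, if_false]
      exact mul_nonpos_of_nonpos_of_nonneg (hB.2.1 i j (by rintro rfl; exact hj hi)) (hβ0 j)
  have ho : ∀ i ∈ T, ∑ j, B i j * (if j ∈ T then 0 else β j) ≤ 0 := fun i hi =>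
    Finset.sum_nonpos fun j _ => hterm i hi j
  have hsymm := sum_symmetrized hd (fun i => ((n i - β i : ℤ) : ℝ)) (fun i => (b i : ℝ))
  simp only [← cast_mulVec] at hsymm
  have hsymm2 : ∑ i, d i * ((n i - β i : ℤ) : ℝ) * (B.mulVec b i : ℤ) =
      ∑ i, d i * (b i : ℝ) * (B.mulVec (n - β) i : ℤ) :=
    hsymm
  have hle : ∑ i, d i * (b i : ℝ) * (B.mulVec (n - β) i : ℤ) ≤ 0 := by
    refine Finset.sum_nonpos fun i _ => ?_
    by_cases hi : i ∈ T
    · have h1 : (0 : ℝ) ≤ b i := by simp only [hb, hi, if_true]; exact_mod_cast hβ0 i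
      have h2 : (B.mulVec (n - β) i : ℤ) ≤ 0 := by
        rw [Matrix.mulVec_sub, Pi.sub_apply]
        have := hn i
        have := hpair i hi
        omega
      exact mul_nonpos_of_nonneg_of_nonpos (mul_nonneg (hd0 i).le h1) (by exact_mod_cast h2)
    · simp [hb, hi]
  have hge : ∀ i, 0 ≤ d i * ((n i - β i : ℤ) : ℝ) * (B.mulVec b i : ℤ) := fun i => by
    by_cases hi : i ∈ T
    · have h1 : (0 : ℝ) ≤ ((n i - β i : ℤ) : ℝ) := by exact_mod_cast sub_nonneg.2 (hβn i)
      have h2 : 0 ≤ B.mulVec b i := by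
        have := hbo i hi
        have := ho i hi
        have := hpair i hi
        omega
      exact mul_nonneg (mul_nonneg (hd0 i).le h1) (by exact_mod_cast h2)
    · simp [hTeq i hi]
  have hb0 : ∀ i ∈ T, B.mulVec b i = 0 := fun i hi => by
    have h1 := (Finset.sum_eq_zero_iff_of_nonneg (fun i _ => hge i)).1
      (le_antisymm (hsymm2.le.trans hle) (Finset.sum_nonneg fun i _ => hge i)) i
      (Finset.mem_univ i)
    have h2 : ((n i - β i : ℤ) : ℝ) ≠ 0 := by
      have h3 : β i < n i := hi
      exact_mod_cast (by omega : n i - β i ≠ 0)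
    have h3 := (mul_eq_zero.1 h1).resolve_left (mul_ne_zero (hd0 i).ne' h2)
    exact_mod_cast h3
  have hβB : ∀ i ∈ T, B.mulVec β i = 0 := fun i hi => by
    have := hbo i hi
    have := ho i hi
    have := hpair i hi
    have := hb0 i hi
    omega
  have ho0 : ∀ i ∈ T, ∑ j, B i j * (if j ∈ T then 0 else β j) = 0 := fun i hi => by
    have := hbo i hi
    have := hβB i hi
    have := hb0 i hi
    omega
  have hedge : ∀ i ∈ T, ∀ j ∉ T, n i ≠ 0 → n j ≠ 0 → B i j = 0 := fun i hi j hj _ hnj => by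
    have h1 := (Finset.sum_eq_zero_iff_of_nonpos (fun j _ => hterm i hi j)).1 (ho0 i hi) j
      (Finset.mem_univ j)
    simp only [hj, if_false] at h1
    exact (mul_eq_zero.1 h1).resolve_right (by rw [hTeq j hj]; exact hnj)
  obtain ⟨i₀, hi₀⟩ : ∃ i, i ∈ T := by
    obtain ⟨i, hi⟩ := Function.ne_iff.1 hβeq
    exact ⟨i, lt_of_le_of_ne (hβn i) hi⟩
  have hTs : ∀ i, n i ≠ 0 → i ∈ T := (hconn T hedge).resolve_right fun h => by
    have h1 : β i₀ < n i₀ := hi₀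
    have h2 := h i₀ hi₀
    have h3 := hβ0 i₀
    simp at h3
    omega
  obtain ⟨i, hi⟩ := hΨ.exists_sub_single_mem β hβ hβ0 hβne
  by_cases hiT : i ∈ T
  · refine hadd i hiT ?_
    have := hΨ.add_single_mem _ hi i 2 (by
      rw [mulVec_sub_single, hB.1, hβB i hiT]; norm_num)
    have h2 : β - Pi.single i 1 + Pi.single i ((2 : ℕ) : ℤ) = β + Pi.single i 1 := by
      rw [sub_add, ← Pi.single_sub, sub_eq_add_neg, ← Pi.single_neg]; norm_num
    rwa [h2] at this
  · have hni : n i = 0 := by_contra fun h => hiT (hTs i h)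
    have hβi : β i = 0 := by rw [hTeq i hiT, hni]
    obtain ⟨j, hj⟩ := Function.ne_iff.1 hβne
    have hji : j ≠ i := by rintro rfl; exact hj hβi
    rcases hΨ.nonneg_or_nonpos _ hi with h | h
    · have := h i
      simp [hβi] at this
    · have h1 := h j
      have h2 := hβ0 j
      simp [Pi.single_eq_of_ne hji] at h1 h2 hj
      omega

theorem IsRootLike.mem_of_mem {Ψ : Set (S → ℤ)} (hΨ : IsRootLike B Ψ) (hB : IsGCM B)
    {d : S → ℝ} (hd0 : ∀ i, 0 < d i) (hd : ∀ i j, d i * (B i j : ℝ) = d j * (B j i : ℝ))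
    (hΨ1 : ∀ i, Pi.single i 1 ∈ Ψ) {Φ : Set (S → ℤ)} (hsign : ∀ n ∈ Φ, 0 ≤ n ∨ n ≤ 0)
    (hsub : ∀ n ∈ Φ, ∀ i, ∀ j : ℕ, (j : ℤ) ≤ (B.mulVec n) i → n - Pi.single i (j : ℤ) ∈ Φ)
    (hone : ∀ i, ∀ p : ℤ, 1 ≤ p → Pi.single i p ∈ Φ → p = 1)
    (hconn : HasConnectedSupports B Φ) {n : S → ℤ} (hn : n ∈ Φ) (h0 : 0 ≤ n) (hn0 : n ≠ 0) :
    n ∈ Ψ := by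
  obtain ⟨N, hN⟩ := Int.eq_ofNat_of_zero_le (Finset.sum_nonneg fun i (_ : i ∈ Finset.univ) => h0 i)
  induction N using Nat.strong_induction_on generalizing n with
  | _ N ih =>
  by_cases h : ∀ i, B.mulVec n i ≤ 0
  · exact hΨ.mem_of_antidominant hB hd0 hd hΨ1 h0 hn0 h (hconn n hn h0)
  push Not at h
  obtain ⟨k, hk⟩ := h
  obtain ⟨m, hm⟩ := Int.eq_ofNat_of_zero_le hk.le
  have h1 : n - Pi.single k (m : ℤ) ∈ Φ := hsub n hn k m hm.ge
  by_cases h2 : n - Pi.single k (m : ℤ) ≤ 0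
  · have h3 := eq_single_of_sub_single_nonpos h0 h2
    have h4 : 1 ≤ n k := by
      by_contra h5
      have h6 : n k = 0 := le_antisymm (by omega) (h0 k)
      rw [h6, Pi.single_zero] at h3
      exact hn0 h3
    rw [h3, hone k _ h4 (h3 ▸ hn)]
    exact hΨ1 k
  · have h3 := (hsign _ h1).resolve_right h2
    have h4 : ∑ i, (n - Pi.single k (m : ℤ) : S → ℤ) i = N - m := by
      simp [Finset.sum_sub_distrib, hN]
    have h5 : 0 ≤ ∑ i, (n - Pi.single k (m : ℤ) : S → ℤ) i := Finset.sum_nonneg fun i _ => h3 i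
    have h6 := ih (N - m) (by omega) h1 h3 (fun h => h2 h.le) (by omega)
    have h7 := hΨ.add_single_mem _ h6 k m (by rw [mulVec_sub_single, hB.1, hm]; omega)
    simpa using h7

end Connected

section Matrices

variable {I : Type*} [Fintype I] [DecidableEq I] {A : Matrix I I ℤ}

omit [Fintype I] [DecidableEq I] in
theorem mem_cmpnt_self {P : Set I} {k : I} (hk : k ∈ P) : k ∈ cmpnt A P k :=
  ⟨hk, Relation.ReflTransGen.refl⟩

omit [Fintype I] [DecidableEq I] in
theorem mem_cmpnt_of_ne_zero {P : Set I} {k i j : I} (hi : i ∈ cmpnt A P k) (hj : j ∈ P)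
    (h : A i j ≠ 0) : j ∈ cmpnt A P k :=
  ⟨hj, hi.2.tail ⟨hi.1, hj, h⟩⟩

theorem nonneg_of_mulVec_nonneg (hA : IsGCM A) {P : Set I} (hP : IsFiniteType (restrictM A P))
    {b : I → ℝ} (hb : ∀ i ∉ P, b i = 0) (hAb : ∀ i ∈ P, 0 ≤ ∑ j, (A i j : ℝ) * b j) (i : I) :
    0 ≤ b i := by
  obtain ⟨u, hu, hu0, hAu⟩ := hP.exists_pos
  by_contra hi
  have hiP : i ∈ P := by_contra fun h => hi (hb i h).ge
  obtain ⟨k, hk, hmin⟩ := Set.exists_min_image P (fun i => b i / u i) P.toFinite ⟨i, hiP⟩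
  have h1 : b k / u k < 0 := (hmin i hiP).trans_lt (div_neg_of_neg_of_pos (not_le.1 hi) (hu i hiP))
  have h2 : ∑ j, (A k j : ℝ) * b j ≤ b k / u k * ∑ j, (A k j : ℝ) * u j := by
    rw [Finset.mul_sum]
    refine Finset.sum_le_sum fun j _ => ?_
    by_cases hj : j ∈ P
    · have h3 := hu j hj
      by_cases hjk : j = k
      · subst hjk
        apply le_of_eq
        field_simp
      · have h4 : (A k j : ℝ) ≤ 0 := by exact_mod_cast hA.2.1 k j (Ne.symm hjk)
        have h5 : b k / u k * u j ≤ b j := (le_div_iff₀ h3).1 (hmin j hj)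
        calc (A k j : ℝ) * b j ≤ (A k j : ℝ) * (b k / u k * u j) :=
              mul_le_mul_of_nonpos_left h5 h4
          _ = _ := by ring
    · simp [hb j hj, hu0 j hj]
  exact absurd (h2.trans_lt (mul_neg_of_neg_of_pos h1 (hAu k hk))) (not_lt.2 (hAb k hk))

variable {J : Set I} {d : I → ℝ}

omit [DecidableEq I] in
theorem sum_mul_div_symmetrizer (hd0 : ∀ i, 0 < d i)
    (hd : ∀ i j, d i * (A i j : ℝ) = d j * (A j i : ℝ)) (C : I → ℝ) (j : I) :
    ∑ i, (A j i : ℝ) * (C i / d i) = (∑ i, C i * (A i j : ℝ)) / d j := by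
  rw [Finset.sum_div]
  refine Finset.sum_congr rfl fun i _ => ?_
  have h1 := hd0 i
  have h2 := hd0 j
  field_simp
  linear_combination C i * hd j i

theorem coeff_pos (hA : IsGCM A) (hd0 : ∀ i, 0 < d i)
    (hd : ∀ i j, d i * (A i j : ℝ) = d j * (A j i : ℝ)) {k : I} {C : I → ℝ}
    (hP : IsFiniteType (restrictM A (cmpnt A (J ∪ {k}) k)))
    (hC0 : ∀ i ∉ cmpnt A (J ∪ {k}) k, C i = 0) (hCJ : ∀ j ∈ J, ∑ i, C i * (A i j : ℝ) = 0)
    (hCk : ∑ i, C i * (A i k : ℝ) = 2) {i : I} (hi : i ∈ cmpnt A (J ∪ {k}) k) : 0 < C i := by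
  have hb : ∀ i ∈ J ∪ {k}, 0 ≤ ∑ j, (A i j : ℝ) * (C j / d j) := by
    rintro i (hi | rfl)
    · rw [sum_mul_div_symmetrizer hd0 hd, hCJ i hi, zero_div]
    · rw [sum_mul_div_symmetrizer hd0 hd, hCk]
      have := hd0 i
      positivity
  have hb0 := nonneg_of_mulVec_nonneg hA hP (b := fun i => C i / d i)
    (fun i hi => by simp [hC0 i hi]) (fun i hi => hb i hi.1)
  have hterm : ∀ i, C i = 0 → ∀ j, (A i j : ℝ) * (C j / d j) ≤ 0 := fun i hi j => by
    by_cases hij : i = j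
    · subst hij; simp [hi]
    · exact mul_nonpos_of_nonpos_of_nonneg (by exact_mod_cast hA.2.1 i j hij) (hb0 j)
  have hC : ∀ i, 0 ≤ C i := fun i => by
    have h1 : C i = C i / d i * d i := by have := (hd0 i).ne'; field_simp
    rw [h1]
    exact mul_nonneg (hb0 i) (hd0 i).le
  have hpos : ∀ i, C i ≠ 0 → 0 < C i := fun i hi => lt_of_le_of_ne (hC i) (Ne.symm hi)
  refine Relation.ReflTransGen.rec ?_ ?_ hi.2
  · refine hpos k fun h => ?_
    have h1 : ∑ j, (A k j : ℝ) * (C j / d j) ≤ 0 := Finset.sum_nonpos fun j _ => hterm k h j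
    rw [sum_mul_div_symmetrizer hd0 hd, hCk] at h1
    exact absurd h1 (not_le.2 (div_pos two_pos (hd0 k)))
  · intro x y _ hxy hx
    refine hpos y fun h => ?_
    have h1 := (Finset.sum_eq_zero_iff_of_nonpos fun j _ => hterm y h j).1
      (le_antisymm (Finset.sum_nonpos fun j _ => hterm y h j) (hb y hxy.2.1)) x
      (Finset.mem_univ x)
    rcases mul_eq_zero.1 h1 with h2 | h2
    · exact hxy.2.2 (hA.2.2 y x (by exact_mod_cast h2))
    · exact (div_pos hx (hd0 x)).ne' h2

variable {A' : Matrix {k : I // k ∉ J} {k : I // k ∉ J} ℤ} {C : {k : I // k ∉ J} → I → ℝ}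

omit [Fintype I] [DecidableEq I] in
theorem not_mem_cmpnt {k l : {k : I // k ∉ J}} (hkl : k ≠ l) :
    l.1 ∉ cmpnt A (J ∪ {k.1}) k.1 := fun h => by
  rcases h.1 with h | h
  · exact l.2 h
  · exact hkl (Subtype.ext h.symm)

theorem reduced_matrix_properties (hA : IsGCM A) (hd0 : ∀ i, 0 < d i)
    (hd : ∀ i j, d i * (A i j : ℝ) = d j * (A j i : ℝ))
    (hP : ∀ k : {k : I // k ∉ J}, IsFiniteType (restrictM A (cmpnt A (J ∪ {k.1}) k.1)))
    (hC0 : ∀ k, ∀ i ∉ cmpnt A (J ∪ {k.1}) k.1, C k i = 0)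
    (hCJ : ∀ k, ∀ j ∈ J, ∑ i, C k i * (A i j : ℝ) = 0)
    (hCA : ∀ k l, ∑ i, C k i * (A i l.1 : ℝ) = A' k l) (h2 : ∀ k, A' k k = 2) :
    IsGCM A' ∧ (∃ d' : {k : I // k ∉ J} → ℝ, (∀ k, 0 < d' k) ∧
      ∀ k l, d' k * (A' k l : ℝ) = d' l * (A' l k : ℝ)) ∧
    ∀ k l, k ≠ l → A' k l = 0 → ∀ i ∈ cmpnt A (J ∪ {k.1}) k.1, A i l.1 = 0 := by
  have hpos : ∀ k, ∀ i ∈ cmpnt A (J ∪ {k.1}) k.1, 0 < C k i := fun k i hi =>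
    coeff_pos hA hd0 hd (hP k) (hC0 k) (hCJ k) (by rw [hCA, h2]; norm_num) hi
  have hCk : ∀ k, 0 < C k k.1 := fun k => hpos k k.1 (mem_cmpnt_self (Or.inr rfl))
  have hterm : ∀ k l, k ≠ l → ∀ i, C k i * (A i l.1 : ℝ) ≤ 0 := fun k l hkl i => by
    by_cases hi : i ∈ cmpnt A (J ∪ {k.1}) k.1
    · refine mul_nonpos_of_nonneg_of_nonpos (hpos k i hi).le ?_
      exact_mod_cast hA.2.1 i l.1 (by rintro rfl; exact not_mem_cmpnt hkl hi)
    · simp [hC0 k i hi]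
  have hzero : ∀ k l, k ≠ l → A' k l = 0 → ∀ i ∈ cmpnt A (J ∪ {k.1}) k.1, A i l.1 = 0 := by
    intro k l hkl h i hi
    have h1 := (Finset.sum_eq_zero_iff_of_nonpos fun i _ => hterm k l hkl i).1
      (by rw [hCA, h, Int.cast_zero]) i (Finset.mem_univ i)
    exact_mod_cast (mul_eq_zero.1 h1).resolve_left (hpos k i hi).ne'
  have hform : ∀ k l, ∑ j, d j * (C l j / d j) * ∑ i, (A j i : ℝ) * (C k i / d i) =
      C l l.1 * (A' k l / d l.1) := fun k l => by
    rw [Finset.sum_eq_single l.1]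
    · have := (hd0 l.1).ne'
      rw [sum_mul_div_symmetrizer hd0 hd, hCA]
      field_simp
    · intro j _ hj
      by_cases hjl : j ∈ cmpnt A (J ∪ {l.1}) l.1
      · rw [sum_mul_div_symmetrizer hd0 hd, hCJ k j (hjl.1.resolve_right hj)]
        simp
      · simp [hC0 l j hjl]
    · simp
  have hsymm : ∀ k l, d k.1 / C k k.1 * (A' k l : ℝ) = d l.1 / C l l.1 * (A' l k : ℝ) := by
    intro k l
    have h1 := sum_symmetrized hd (fun i => C l i / d i) (fun i => C k i / d i)
    rw [hform, hform] at h1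
    have := hCk k
    have := hCk l
    have := hd0 k.1
    have := hd0 l.1
    field_simp at h1 ⊢
    linear_combination h1
  refine ⟨⟨h2, fun k l hkl => ?_, fun k l h => ?_⟩,
    ⟨fun k => d k.1 / C k k.1, fun k => div_pos (hd0 _) (hCk k), hsymm⟩, hzero⟩
  · have : (A' k l : ℝ) ≤ 0 := by
      rw [← hCA]
      exact Finset.sum_nonpos fun i _ => hterm k l hkl i
    exact_mod_cast this
  · have h1 := hsymm k l
    rw [h, Int.cast_zero, mul_zero] at h1
    exact_mod_cast (mul_eq_zero.1 h1.symm).resolve_left (div_pos (hd0 _) (hCk l)).ne'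

/-- The restriction of a tuple to the complement of `J`. -/
def res (J : Set I) (m : I → ℤ) : {k : I // k ∉ J} → ℤ := fun k => m k.1

omit [Fintype I] in
theorem HasConnectedSupports.res {X : Set (I → ℤ)} (hX : HasConnectedSupports A X)
    (hsign : ∀ m ∈ X, 0 ≤ m ∨ m ≤ 0)
    (hzero : ∀ k l, k ≠ l → A' k l = 0 → ∀ i ∈ cmpnt A (J ∪ {k.1}) k.1, A i l.1 = 0) :
    HasConnectedSupports A' (res J '' X) := by
  rintro _ ⟨m, hm, rfl⟩ h0 P hP
  rcases hsign m hm with h | h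
  swap
  · exact Or.inr fun k _ => le_antisymm (h k.1) (h0 k)
  have key := hX m hm h {i | ∃ k ∈ P, m k.1 ≠ 0 ∧ i ∈ cmpnt A (J ∪ {k.1}) k.1} (by
    rintro i ⟨k, hk, hk0, hik⟩ j hj _ hj0
    by_contra hij
    by_cases hjJ : j ∈ J
    · exact hj ⟨k, hk, hk0, mem_cmpnt_of_ne_zero hik (Or.inl hjJ) hij⟩
    · have hjP : (⟨j, hjJ⟩ : {k : I // k ∉ J}) ∉ P := fun h1 =>
        hj ⟨⟨j, hjJ⟩, h1, hj0, mem_cmpnt_self (Or.inr rfl)⟩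
      exact hij (hzero k ⟨j, hjJ⟩ (by rintro rfl; exact hjP hk)
        (hP k hk ⟨j, hjJ⟩ hjP hk0 hj0) i hik))
  rcases key with h1 | h1
  · left
    intro k hk
    obtain ⟨l, hl, hl0, hkl⟩ := h1 k.1 hk
    by_cases hlk : l = k
    · exact hlk ▸ hl
    · exact absurd hkl (not_mem_cmpnt hlk)
  · right
    intro k hk
    by_contra hk0
    exact hk0 (h1 k.1 ⟨k, hk, hk0, mem_cmpnt_self (Or.inr rfl)⟩)

omit [Fintype I] in
theorem HasConnectedSupports.mem_cmpnt_of_res_eq_single {X : Set (I → ℤ)}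
    (hX : HasConnectedSupports A X) (hsign : ∀ m ∈ X, 0 ≤ m ∨ m ≤ 0) {m : I → ℤ} (hm : m ∈ X)
    {k : {k : I // k ∉ J}} {p : ℤ} (hp : 1 ≤ p) (h : KMG.res J m = Pi.single k p) :
    0 ≤ m ∧ m ≠ 0 ∧ ∀ i, m i ≠ 0 → i ∈ cmpnt A (J ∪ {k.1}) k.1 := by
  have hk : m k.1 = p := by simpa [KMG.res] using congrFun h k
  have h0 : 0 ≤ m := (hsign m hm).resolve_right fun h1 => by
    have h2 := h1 k.1
    simp [hk] at h2
    omega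
  refine ⟨h0, fun h1 => ?_, ?_⟩
  · rw [h1] at hk; simp at hk; omega
  · refine (hX m hm h0 (cmpnt A (J ∪ {k.1}) k.1) fun i hi j hj _ hj0 => ?_).resolve_right fun h1 => ?_
    · by_contra hij
      refine hj (mem_cmpnt_of_ne_zero hi ?_ hij)
      by_contra hjJ
      rw [Set.mem_union, not_or] at hjJ
      have h1 := congrFun h ⟨j, hjJ.1⟩
      have h2 : (⟨j, hjJ.1⟩ : {k : I // k ∉ J}) ≠ k := fun h2 =>
        hjJ.2 (Set.mem_singleton_iff.2 (congrArg Subtype.val h2))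
      rw [Pi.single_eq_of_ne h2] at h1
      exact hj0 h1
    · have := h1 k.1 (mem_cmpnt_self (Or.inr rfl))
      omega

end Matrices

section LocalNilpotency

variable {g : Type*} [LieRing g] [LieAlgebra ℂ g] {V : Type*} [AddCommGroup V] [Module ℂ V]
  {ι : V →ₗ[ℂ] g}

theorem exists_ad_pow_eq_zero_of_mem (hι : ∀ v w, ⁅ι v, ι w⁆ = 0) {U : Submodule ℂ g}
    [FiniteDimensional ℂ U] {χ ψ : Dual ℂ V} (hψ : ψ ≠ 0) {x y : g} (hx : x ∈ wtSpaceι ι χ)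
    (hy : y ∈ wtSpaceι ι ψ) (hxU : x ∈ U) (hyU : ∀ u ∈ U, ⁅y, u⁆ ∈ U) :
    ∃ r, (LieAlgebra.ad ℂ g y ^ r) x = 0 := by
  by_contra! h
  have hU : ∀ p : ℕ, (LieAlgebra.ad ℂ g y ^ p) x ∈ U := fun p => by
    induction p with
    | zero => simpa using hxU
    | succ p ih => rw [pow_succ', Module.End.mul_apply]; exact hyU _ ih
  have hinj : Function.Injective fun p : ℕ => χ + (p : ℂ) • ψ := fun p q hpq => by
    have h1 : (p : ℂ) • ψ = (q : ℂ) • ψ := add_left_cancel hpq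
    exact_mod_cast smul_left_injective ℂ hψ h1
  have hli : LinearIndependent ℂ fun p : ℕ => (LieAlgebra.ad ℂ g y ^ p) x :=
    ((iSupIndep_wtSpaceι hι).comp hinj).linearIndependent _
      (fun p => ad_pow_mem_wtSpaceι hx hy p) h
  refine Module.Finite.not_linearIndependent_of_infinite (R := ℂ) (M := U)
    (fun p : ℕ => ⟨(LieAlgebra.ad ℂ g y ^ p) x, hU p⟩) ?_
  exact LinearIndependent.of_comp U.subtype hli

end LocalNilpotency

section Components

variable {I : Type*} [Fintype I] [DecidableEq I] {A : Matrix I I ℤ}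
  {g : Type*} [LieRing g] [LieAlgebra ℂ g] {G : KacMoodyAlgebra A g}

theorem lie_eq_zero_of_mem_gS {P : Set I} {h : G.H} (hh : ∀ i ∈ P, G.root i h = 0) {x : g}
    (hx : x ∈ gS G P) : ⁅(h : g), x⁆ = 0 := by
  induction hx using LieSubalgebra.lieSpan_induction with
  | mem x hx =>
    rcases hx with ⟨i, hi, rfl⟩ | ⟨i, hi, rfl⟩
    · rw [G.lie_e, hh i hi, zero_smul]
    · rw [G.lie_f, hh i hi, neg_zero, zero_smul]
  | zero => exact lie_zero _
  | add x y _ _ hx hy => rw [lie_add, hx, hy, add_zero]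
  | smul a x _ hx => rw [lie_smul, hx, smul_zero]
  | lie x y _ _ hx hy => rw [leibniz_lie, hx, hy, zero_lie, lie_zero, add_zero]

theorem gS_opp (P : Set I) : gS G.opp P = gS G P := by
  unfold gS
  rw [Set.union_comm]
  rfl

theorem lie_mem_iSup_wt {P : Set I} {m : I → ℤ} {y : g} (hy : y ∈ gS G P) {u : g}
    (hu : u ∈ ⨆ n : {n : I → ℤ // ∀ i ∉ P, n i = m i}, G.wt n.1) :
    ⁅y, u⁆ ∈ ⨆ n : {n : I → ℤ // ∀ i ∉ P, n i = m i}, G.wt n.1 := by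
  set U := ⨆ n : {n : I → ℤ // ∀ i ∉ P, n i = m i}, G.wt n.1 with hU
  have key : ∀ (z : I → ℤ) (w : g), (∀ i ∉ P, z i = 0) → w ∈ G.wt z →
      w ∈ KacMoodyAlgebra.stabilizer U := by
    intro z w hz hw
    have h1 : U ≤ U.comap (LieAlgebra.ad ℂ g w : g →ₗ[ℂ] g) := by
      conv_lhs => rw [hU]
      refine iSup_le fun n x hx => ?_
      exact Submodule.mem_iSup_of_mem
        (⟨z + n.1, fun i hi => by rw [Pi.add_apply, hz i hi, zero_add, n.2 i hi]⟩ :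
          {n : I → ℤ // ∀ i ∉ P, n i = m i}) (G.lie_mem_wt hw hx)
    exact fun u hu => h1 hu
  have h2 : gS G P ≤ KacMoodyAlgebra.stabilizer U := by
    unfold gS
    rw [LieSubalgebra.lieSpan_le]
    rintro _ (⟨i, hi, rfl⟩ | ⟨i, hi, rfl⟩)
    · exact key (Pi.single i 1) _ (fun j hj => Pi.single_eq_of_ne (by rintro rfl; exact hj hi) _)
        (G.e_mem_wt i)
    · exact key (-Pi.single i 1) _ (fun j hj => by
        rw [Pi.neg_apply, Pi.single_eq_of_ne (by rintro rfl; exact hj hi), neg_zero]) (G.f_mem_wt i)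
  exact h2 hy u hu

theorem finiteDimensional_iSup_wt {p : (I → ℤ) → Prop} (hp : {n ∈ G.weights | p n}.Finite) :
    FiniteDimensional ℂ (⨆ n : {n : I → ℤ // p n}, G.wt n.1 : Submodule ℂ g) := by
  have : ∀ n, FiniteDimensional ℂ (G.wt n) := G.finiteDimensional_wt
  refine Submodule.finiteDimensional_of_le (S₂ := hp.toFinset.sup G.wt) (iSup_le fun n => ?_)
  by_cases hn : n.1 ∈ G.weights
  · exact Finset.le_sup (f := G.wt) (hp.mem_toFinset.2 ⟨hn, n.2⟩)
  · rw [show G.wt n.1 = ⊥ by simpa [KacMoodyAlgebra.weights] using hn]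
    exact bot_le

theorem finite_weights (hA : IsGCM A) {d : I → ℝ} (hd0 : ∀ i, 0 < d i)
    (hd : ∀ i j, d i * (A i j : ℝ) = d j * (A j i : ℝ)) (G : KacMoodyAlgebra A g) {P : Set I}
    (hP : IsFiniteType (restrictM A P)) (m : I → ℤ) :
    {n ∈ G.weights | ∀ i ∉ P, n i = m i}.Finite :=
  finite_of_isRootLike (G.isRootLike_weights hA.1)
    (G.opp_weights ▸ G.opp.isRootLike_weights hA.1) hA hd0 hd hP m

theorem IsHGen.exists_coeff {P : Set I} {k : I} {h : G.H} (hh : IsHGen G P k h) :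
    ∃ C : I → ℂ, (∀ i ∉ P, C i = 0) ∧ ∀ j, G.root j h = ∑ i, C i * (A i j : ℂ) := by
  obtain ⟨h1, -⟩ := hh
  induction h1 using Submodule.span_induction with
  | mem x hx =>
    obtain ⟨i, hi, rfl⟩ := hx
    refine ⟨Pi.single i 1, fun j hj => Pi.single_eq_of_ne (by rintro rfl; exact hj hi) _,
      fun j => ?_⟩
    rw [G.pairing, Finset.sum_eq_single i] <;> simp +contextual
  | zero => exact ⟨0, fun _ _ => rfl, fun j => by simp⟩
  | add x y _ _ hx hy =>
    obtain ⟨C, hC, hx⟩ := hx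
    obtain ⟨C', hC', hy⟩ := hy
    exact ⟨C + C', fun i hi => by simp [hC i hi, hC' i hi], fun j => by
      simp [hx, hy, add_mul, Finset.sum_add_distrib]⟩
  | smul a x _ hx =>
    obtain ⟨C, hC, hx⟩ := hx
    exact ⟨a • C, fun i hi => by simp [hC i hi], fun j => by
      simp [hx, mul_assoc, Finset.mul_sum]⟩

theorem IsHGen.root_eq_zero {J : Set I} {k : I} (hk : k ∉ J) {h : G.H}
    (hh : IsHGen G (cmpnt A (J ∪ {k}) k) k h) {j : I} (hj : j ∈ J) : G.root j h = 0 := by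
  by_cases hjk : j ∈ cmpnt A (J ∪ {k}) k
  · rw [hh.2 j hjk, if_neg (by rintro rfl; exact hk hj)]
  · obtain ⟨C, hC0, hC⟩ := hh.exists_coeff
    rw [hC]
    refine Finset.sum_eq_zero fun i _ => ?_
    by_cases hi : i ∈ cmpnt A (J ∪ {k}) k
    · rw [show A i j = 0 from by_contra fun h1 => hjk (mem_cmpnt_of_ne_zero hi (Or.inl hj) h1)]
      simp
    · rw [hC0 i hi, zero_mul]

theorem A1GradedBy.lie_lie_lie {P : Set I} {h : g} (hh : A1GradedBy G P h) {x : g}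
    (hx : x ∈ gS G P) : ⁅h, ⁅h, ⁅h, x⁆⁆⁆ = (4 : ℂ) • ⁅h, x⁆ := by
  obtain ⟨y, hy, c, hc, rfl⟩ := Submodule.mem_sup.1 (hh x hx)
  obtain ⟨a, ha, b, hb, rfl⟩ := Submodule.mem_sup.1 hy
  rw [Module.End.mem_eigenspace_iff, LieAlgebra.ad_apply] at ha hb hc
  simp only [lie_add, ha, hb, hc, lie_smul, smul_smul, smul_add]
  norm_num

end Components

namespace CAdmissibleData.IsAssocKM

variable {I : Type*} [Fintype I] [DecidableEq I] {A : Matrix I I ℤ}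
  {g : Type*} [LieRing g] [LieAlgebra ℂ g] {G : KacMoodyAlgebra A g} {J : Set I}
  {D : CAdmissibleData G J} {A' : Matrix {k : I // k ∉ J} {k : I // k ∉ J} ℤ}
  {GJ : KacMoodyAlgebra A' ↥D.gJ} (hGJ : D.IsAssocKM GJ)
include hGJ

theorem coe_mem_map (v : GJ.H) : ((v : D.gJ) : g) ∈ (hJsub G J).map G.H.subtype := by
  rw [← hGJ.2.1]
  exact Submodule.mem_map_of_mem v.2

theorem map_le : GJ.H.map D.gJ.incl.toLinearMap ≤ G.H := by
  rintro _ ⟨v, hv, rfl⟩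
  obtain ⟨w, -, hw⟩ := hGJ.coe_mem_map ⟨v, hv⟩
  change D.gJ.incl v ∈ G.H
  rw [← show (w : g) = D.gJ.incl v from hw]
  exact w.2

/-- The inclusion of the Cartan subalgebra of `g^J` into that of `g`. -/
def cartanMap : GJ.H →ₗ[ℂ] G.H := cartanIncl G GJ D.gJ.incl hGJ.map_le

theorem coe_cartanMap (v : GJ.H) : (hGJ.cartanMap v : g) = ((v : D.gJ) : g) := rfl

theorem root_cartanMap_of_mem {j : I} (hj : j ∈ J) (v : GJ.H) :
    G.root j (hGJ.cartanMap v) = 0 := by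
  obtain ⟨w, hw, hwv⟩ := hGJ.coe_mem_map v
  have : w = hGJ.cartanMap v := Subtype.ext hwv
  rw [← this]
  exact (Submodule.mem_iInf _).1 ((Submodule.mem_iInf _).1 hw j) hj

theorem cartanMap_coroot (k : {k : I // k ∉ J}) : hGJ.cartanMap (GJ.coroot k) = D.Hc k :=
  Subtype.ext (hGJ.2.2.1 k)

theorem lie_E (v : GJ.H) (k : {k : I // k ∉ J}) : ⁅((v : D.gJ) : g), D.E k⁆ = GJ.root k v • D.E k := by
  rw [← hGJ.2.2.2.1 k, ← LieSubalgebra.coe_bracket, GJ.lie_e]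
  rfl

theorem lie_F (v : GJ.H) (k : {k : I // k ∉ J}) :
    ⁅((v : D.gJ) : g), D.F k⁆ = -GJ.root k v • D.F k := by
  rw [← hGJ.2.2.2.2 k, ← LieSubalgebra.coe_bracket, GJ.lie_f]
  rfl

theorem root_cartanMap (k : {k : I // k ∉ J}) (v : GJ.H) :
    G.root k.1 (hGJ.cartanMap v) = GJ.root k v := by
  set h := hGJ.cartanMap v with hh
  have hk := mem_cmpnt_self (A := A) (P := J ∪ {k.1}) (k := k.1) (Or.inr rfl)
  have h1 : ∀ i ∈ cmpnt A (J ∪ {k.1}) k.1, G.root i (h - (G.root k.1 h / 2) • D.Hc k) = 0 := by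
    intro i hi
    rw [map_sub, map_smul, (D.isHGen k).2 i hi]
    by_cases hik : i = k.1
    · subst hik
      rw [if_pos rfl, smul_eq_mul]; ring
    · have hiJ : i ∈ J := hi.1.resolve_right hik
      rw [if_neg hik, smul_zero, sub_zero, hh, hGJ.root_cartanMap_of_mem hiJ]
  have h2 := lie_eq_zero_of_mem_gS h1 (D.memE k)
  rw [Submodule.coe_sub, Submodule.coe_smul, sub_lie, smul_lie, (D.sl2 k).lie_h_e_nsmul,
    hh, hGJ.coe_cartanMap, hGJ.lie_E, ← ofNat_smul_eq_nsmul ℂ, smul_smul, ← sub_smul, ← hh] at h2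
  have h3 := (smul_eq_zero.1 h2).resolve_right (D.sl2 k).e_ne_zero
  linear_combination -h3

theorem ofCoord_cartanMap (m : I → ℤ) (v : GJ.H) :
    G.ofCoord m (hGJ.cartanMap v) = GJ.ofCoord (res J m) v := by
  simp only [KacMoodyAlgebra.ofCoord, LinearMap.coe_sum, Finset.sum_apply, LinearMap.smul_apply]
  refine (Fintype.sum_of_injective Subtype.val Subtype.val_injective _ _ (fun i hi => ?_)
    (fun k => ?_)).symm
  · rw [hGJ.root_cartanMap_of_mem (by simpa using hi), smul_zero]
  · rw [hGJ.root_cartanMap]; rfl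

theorem lie_incl (v w : GJ.H) : ⁅(D.gJ.incl.toLinearMap ∘ₗ GJ.H.subtype) v,
    (D.gJ.incl.toLinearMap ∘ₗ GJ.H.subtype) w⁆ = 0 :=
  G.abelian (hGJ.cartanMap v) (hGJ.cartanMap w)

theorem wt_le (m : I → ℤ) :
    G.wt m ≤ wtSpaceι (D.gJ.incl.toLinearMap ∘ₗ GJ.H.subtype) (GJ.ofCoord (res J m)) :=
  fun x hx v => by
  rw [← hGJ.ofCoord_cartanMap]
  exact hx (hGJ.cartanMap v)

theorem lie_Hc {m : I → ℤ} {x : g} (hx : x ∈ G.wt m) (k : {k : I // k ∉ J}) :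
    ⁅(D.Hc k : g), x⁆ = ((A'.mulVec (res J m) k : ℤ) : ℂ) • x := by
  rw [← GJ.ofCoord_coroot, ← hGJ.ofCoord_cartanMap, hGJ.cartanMap_coroot]
  exact hx (D.Hc k)

theorem iSup_wt_eq (χ : Dual ℂ GJ.H) :
    ⨆ m : {m : I → ℤ // GJ.ofCoord (res J m) = χ}, G.wt m.1 =
      wtSpaceι (D.gJ.incl.toLinearMap ∘ₗ GJ.H.subtype) χ := by
  refine eq_wtSpaceι_of_iSup_eq_top hGJ.lie_incl (N := fun χ =>
    ⨆ m : {m : I → ℤ // GJ.ofCoord (res J m) = χ}, G.wt m.1) (fun χ => iSup_le fun m => ?_) ?_ χ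
  · exact (hGJ.wt_le m.1).trans_eq (by rw [m.2])
  · rw [eq_top_iff, ← G.weight_decomp]
    refine iSup_le fun ψ => ?_
    by_cases hψ : wtSpaceι G.H.subtype ψ = ⊥
    · rw [hψ]; exact bot_le
    · obtain ⟨m, -, rfl, -⟩ := G.exists_mem_weights_of_wtSpaceι_ne_bot hψ
      exact le_iSup_of_le (GJ.ofCoord (res J m))
        (le_iSup (fun n : {n : I → ℤ // GJ.ofCoord (res J n) = GJ.ofCoord (res J m)} => G.wt n.1)
          ⟨m, rfl⟩)

theorem exists_mem_weights {χ : Dual ℂ GJ.H}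
    (hχ : wtSpaceι (D.gJ.incl.toLinearMap ∘ₗ GJ.H.subtype) χ ≠ ⊥) :
    ∃ n ∈ res J '' G.weights, GJ.ofCoord n = χ := by
  by_contra! h
  refine hχ ?_
  rw [← hGJ.iSup_wt_eq, iSup_eq_bot]
  rintro ⟨m, hm⟩
  by_contra hw
  exact h _ ⟨m, hw, rfl⟩ hm

theorem mem_image_of_mem_wtSpaceι {n : {k : I // k ∉ J} → ℤ} {x : g}
    (hx : x ∈ wtSpaceι (D.gJ.incl.toLinearMap ∘ₗ GJ.H.subtype) (GJ.ofCoord n)) (hx0 : x ≠ 0) :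
    n ∈ res J '' G.weights := by
  obtain ⟨n', hn', h⟩ := hGJ.exists_mem_weights ((Submodule.ne_bot_iff _).2 ⟨x, hx, hx0⟩)
  exact GJ.ofCoord_injective h ▸ hn'

theorem E_mem_wtSpaceι (k : {k : I // k ∉ J}) :
    D.E k ∈ wtSpaceι (D.gJ.incl.toLinearMap ∘ₗ GJ.H.subtype) (GJ.root k) := fun v => hGJ.lie_E v k

theorem F_mem_wtSpaceι (k : {k : I // k ∉ J}) :
    D.F k ∈ wtSpaceι (D.gJ.incl.toLinearMap ∘ₗ GJ.H.subtype) (-GJ.root k) := fun v => hGJ.lie_F v k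

theorem two_eq (k : {k : I // k ∉ J}) : A' k k = 2 := by
  have h := hGJ.1 k k
  rw [(D.isHGen k).2 k.1 (mem_cmpnt_self (Or.inr rfl)), if_pos rfl] at h
  exact_mod_cast h

theorem matrix_properties (hA : IsGCM A) {d : I → ℝ} (hd0 : ∀ i, 0 < d i)
    (hd : ∀ i j, d i * (A i j : ℝ) = d j * (A j i : ℝ)) :
    IsGCM A' ∧ (∃ d' : {k : I // k ∉ J} → ℝ, (∀ k, 0 < d' k) ∧
      ∀ k l, d' k * (A' k l : ℝ) = d' l * (A' l k : ℝ)) ∧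
    ∀ k l, k ≠ l → A' k l = 0 → ∀ i ∈ cmpnt A (J ∪ {k.1}) k.1, A i l.1 = 0 := by
  choose C hC0 hC using fun k => (D.isHGen k).exists_coeff
  have hre : ∀ k j, ∑ i, (C k i).re * (A i j : ℝ) = (G.root j (D.Hc k)).re := fun k j => by
    rw [hC, Complex.re_sum]
    exact Finset.sum_congr rfl fun i _ => by simp
  refine reduced_matrix_properties (C := fun k i => (C k i).re) hA hd0 hd D.finIk
    (fun k i hi => by simp [hC0 k i hi]) (fun k j hj => ?_) (fun k l => ?_) hGJ.two_eq
  · rw [hre, (D.isHGen k).root_eq_zero k.2 hj, Complex.zero_re]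
  · rw [hre, ← hGJ.1 k l, Complex.intCast_re]

end CAdmissibleData.IsAssocKM

namespace CAdmissibleData.IsAssocKM

variable {I : Type*} [Fintype I] [DecidableEq I] {A : Matrix I I ℤ}
  {g : Type*} [LieRing g] [LieAlgebra ℂ g] {G : KacMoodyAlgebra A g} {J : Set I}
  {D : CAdmissibleData G J} {A' : Matrix {k : I // k ∉ J} {k : I // k ∉ J} ℤ}
  {GJ : KacMoodyAlgebra A' ↥D.gJ} (hGJ : D.IsAssocKM GJ) (hA : IsGCM A) {d : I → ℝ}
  (hd0 : ∀ i, 0 < d i) (hd : ∀ i j, d i * (A i j : ℝ) = d j * (A j i : ℝ))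

include hGJ hA hd0 hd

theorem finiteDimensional_wtSpaceι (χ : Dual ℂ GJ.H) :
    FiniteDimensional ℂ (wtSpaceι (D.gJ.incl.toLinearMap ∘ₗ GJ.H.subtype) χ) := by
  rw [← hGJ.iSup_wt_eq]
  by_cases h : ∃ m : I → ℤ, GJ.ofCoord (res J m) = χ
  · obtain ⟨m, rfl⟩ := h
    refine finiteDimensional_iSup_wt ((finite_weights hA hd0 hd G D.finJ m).subset ?_)
    exact fun n hn => ⟨hn.1, fun i hi => congrFun (GJ.ofCoord_injective hn.2) ⟨i, hi⟩⟩
  · rw [show (⨆ m : {m : I → ℤ // GJ.ofCoord (res J m) = χ}, G.wt m.1) = ⊥ from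
      iSup_eq_bot.2 fun m => absurd ⟨m.1, m.2⟩ h]
    infer_instance

theorem exists_ad_pow_eq_zero {k : {k : I // k ∉ J}} {y : g}
    (hy : y ∈ gS G (cmpnt A (J ∪ {k.1}) k.1)) {ψ : Dual ℂ GJ.H} (hψ : ψ ≠ 0)
    (hyψ : y ∈ wtSpaceι (D.gJ.incl.toLinearMap ∘ₗ GJ.H.subtype) ψ) {m : I → ℤ} {x : g}
    (hx : x ∈ G.wt m) : ∃ r, (LieAlgebra.ad ℂ g y ^ r) x = 0 := by
  have := finiteDimensional_iSup_wt (finite_weights hA hd0 hd G (D.finIk k) m)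
  exact exists_ad_pow_eq_zero_of_mem hGJ.lie_incl hψ (hGJ.wt_le m hx) hyψ
    (Submodule.mem_iSup_of_mem
      (⟨m, fun _ _ => rfl⟩ : {n : I → ℤ // ∀ i ∉ cmpnt A (J ∪ {k.1}) k.1, n i = m i}) hx)
    (fun u hu => lie_mem_iSup_wt hy hu)

theorem add_single_mem {n : {k : I // k ∉ J} → ℤ} (hn : n ∈ res J '' G.weights)
    (k : {k : I // k ∉ J}) (j : ℕ) (hj : (j : ℤ) ≤ -(A'.mulVec n) k) :
    n + Pi.single k (j : ℤ) ∈ res J '' G.weights := by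
  obtain ⟨m, hm, rfl⟩ := hn
  obtain ⟨x, hx, hx0⟩ := Submodule.exists_mem_ne_zero_of_ne_bot hm
  obtain ⟨q, hq⟩ : ∃ q : ℕ, A'.mulVec (res J m) k = -(q : ℤ) :=
    ⟨(-(A'.mulVec (res J m)) k).toNat, by omega⟩
  obtain ⟨p, hp⟩ := exists_ad_pow_ad_pow_ne_zero (D.sl2 k) hx0 (m := q) (j := j)
    (by rw [hGJ.lie_Hc hx, hq]; simp)
    (hGJ.exists_ad_pow_eq_zero hA hd0 hd (D.memF k) (neg_ne_zero.2 (GJ.indepRoot.ne_zero k))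
      (hGJ.F_mem_wtSpaceι k) hx) (by omega)
  refine hGJ.mem_image_of_mem_wtSpaceι (?_ : _ ∈ wtSpaceι _ _) hp
  have h := ad_pow_mem_wtSpaceι (ad_pow_mem_wtSpaceι (hGJ.wt_le m hx) (hGJ.F_mem_wtSpaceι k) p)
    (hGJ.E_mem_wtSpaceι k) (p + j)
  convert h using 2
  rw [GJ.ofCoord_add, GJ.ofCoord_single]
  push_cast
  module

theorem sub_single_mem {n : {k : I // k ∉ J} → ℤ} (hn : n ∈ res J '' G.weights)
    (k : {k : I // k ∉ J}) (j : ℕ) (hj : (j : ℤ) ≤ (A'.mulVec n) k) :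
    n - Pi.single k (j : ℤ) ∈ res J '' G.weights := by
  obtain ⟨m, hm, rfl⟩ := hn
  obtain ⟨x, hx, hx0⟩ := Submodule.exists_mem_ne_zero_of_ne_bot hm
  obtain ⟨q, hq⟩ : ∃ q : ℕ, A'.mulVec (res J m) k = (q : ℤ) :=
    Int.eq_ofNat_of_zero_le (by omega)
  obtain ⟨p, hp⟩ := exists_ad_pow_ad_pow_ne_zero (D.sl2 k).symm hx0 (m := q) (j := j)
    (by rw [neg_lie, hGJ.lie_Hc hx, hq]; simp)
    (hGJ.exists_ad_pow_eq_zero hA hd0 hd (D.memE k) (GJ.indepRoot.ne_zero k)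
      (hGJ.E_mem_wtSpaceι k) hx) (by omega)
  refine hGJ.mem_image_of_mem_wtSpaceι (?_ : _ ∈ wtSpaceι _ _) hp
  have h := ad_pow_mem_wtSpaceι (ad_pow_mem_wtSpaceι (hGJ.wt_le m hx) (hGJ.E_mem_wtSpaceι k) p)
    (hGJ.F_mem_wtSpaceι k) (p + j)
  convert h using 2
  rw [sub_eq_add_neg, GJ.ofCoord_add, GJ.ofCoord_neg, GJ.ofCoord_single]
  push_cast
  module

omit hA hd0 hd in
theorem mul_self_eq_one {m : I → ℤ} {k : {k : I // k ∉ J}} {p : ℤ} (hm : m ∈ G.weights)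
    (hmk : res J m = Pi.single k p) (hp : p ≠ 0)
    (hle : G.wt m ≤ (gS G (cmpnt A (J ∪ {k.1}) k.1)).toSubmodule) : p * p = 1 := by
  obtain ⟨x, hx, hx0⟩ := Submodule.exists_mem_ne_zero_of_ne_bot hm
  have h1 : ⁅(D.Hc k : g), x⁆ = (2 * p : ℂ) • x := by
    rw [hGJ.lie_Hc hx, hmk]
    simp [hGJ.two_eq]
  have h2 := (D.a1 k).lie_lie_lie (hle hx)
  simp only [h1, lie_smul, smul_smul] at h2
  have h3 : ((2 * p * (2 * p) * (2 * p) : ℤ) : ℂ) = ((4 * (2 * p) : ℤ) : ℂ) := by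
    push_cast
    exact smul_left_injective ℂ hx0 (by simpa [mul_assoc] using h2)
  have h4 : 2 * p * (2 * p) * (2 * p) = 4 * (2 * p) := by exact_mod_cast h3
  have h5 : p * (p * p - 1) = 0 := by linarith
  linarith [(mul_eq_zero.1 h5).resolve_left hp]

theorem mem_weights_of_mem {n : {k : I // k ∉ J} → ℤ} (hn : n ∈ res J '' G.weights)
    (hn0 : n ≠ 0) : n ∈ GJ.weights := by
  obtain ⟨hA', ⟨d', hd0', hd'⟩, hzero⟩ := hGJ.matrix_properties hA hd0 hd
  have hX := G.isRootLike_weights hA.1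
  have hXn : IsRootLike A (-G.weights) := G.opp_weights ▸ G.opp.isRootLike_weights hA.1
  have hneg : -(res J '' G.weights) = res J '' (-G.weights) := by
    ext z
    constructor
    · rintro ⟨m, hm, h⟩
      exact ⟨-m, by simpa using hm, by rw [← neg_eq_iff_eq_neg.2 h]; rfl⟩
    · rintro ⟨m, hm, rfl⟩
      exact ⟨-m, hm, rfl⟩
  have hsign : ∀ n ∈ res J '' G.weights, 0 ≤ n ∨ n ≤ 0 := by
    rintro _ ⟨m, hm, rfl⟩
    exact (hX.nonneg_or_nonpos m hm).imp (fun h k => h k.1) (fun h k => h k.1)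
  have hpos : ∀ p : ℤ, 1 ≤ p → p * p = 1 → p = 1 := fun p hp h => by nlinarith
  rcases hsign n hn with h0 | h0
  · refine (GJ.isRootLike_weights hA'.1).mem_of_mem hA' hd0' hd' (fun k => ?_) hsign
      (fun n hn => hGJ.sub_single_mem hA hd0 hd hn) (fun k p hp h => ?_)
      ((hX.hasConnectedSupports hA).res hX.nonneg_or_nonpos hzero) hn h0 hn0
    · exact (Submodule.ne_bot_iff _).2 ⟨_, GJ.e_mem_wt k, GJ.e_ne_zero k⟩
    · obtain ⟨m, hm, hmk⟩ := h
      obtain ⟨h1, h2, h3⟩ := (hX.hasConnectedSupports hA).mem_cmpnt_of_res_eq_single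
        hX.nonneg_or_nonpos hm hp hmk
      exact hpos p hp (hGJ.mul_self_eq_one hm hmk (by omega) (KacMoodyAlgebra.wt_le_gS h1 h2 h3))
  · suffices h : -n ∈ GJ.opp.weights from KacMoodyAlgebra.mem_weights_of_opp h
    refine (GJ.opp.isRootLike_weights hA'.1).mem_of_mem hA' hd0' hd' (fun k => ?_)
      (Φ := -(res J '' G.weights)) (fun z hz => ?_) (fun z hz k j hj => ?_) (fun k p hp h => ?_) ?_
      (by simpa using hn) (neg_nonneg.2 h0) (neg_ne_zero.2 hn0)
    · exact (Submodule.ne_bot_iff _).2 ⟨_, GJ.opp.e_mem_wt k, GJ.opp.e_ne_zero k⟩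
    · exact (hsign _ hz).symm.imp neg_nonpos.1 neg_nonneg.1
    · rw [Set.mem_neg, neg_sub, sub_eq_neg_add]
      exact hGJ.add_single_mem hA hd0 hd hz k j (by simpa [Matrix.mulVec_neg] using hj)
    · rw [hneg] at h
      obtain ⟨m, hm, hmk⟩ := h
      obtain ⟨h1, h2, h3⟩ := (hXn.hasConnectedSupports hA).mem_cmpnt_of_res_eq_single
        hXn.nonneg_or_nonpos hm hp hmk
      have h4 := KacMoodyAlgebra.wt_le_gS (K := G.opp) h1 h2 h3
      rw [G.opp_wt, gS_opp] at h4
      have h5 := hGJ.mul_self_eq_one (m := -m) (p := -p) hm (by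
        rw [Pi.single_neg, ← hmk]; rfl) (by omega) h4
      exact hpos p hp (by linarith)
    · rw [hneg]
      exact (hXn.hasConnectedSupports hA).res hXn.nonneg_or_nonpos hzero

theorem wtSpaceι_ne_bot_iff {χ : Dual ℂ GJ.H} (hχ : χ ≠ 0) :
    wtSpaceι (D.gJ.incl.toLinearMap ∘ₗ GJ.H.subtype) χ ≠ ⊥ ↔ χ ∈ Delta GJ := by
  refine ⟨fun h => ⟨hχ, ?_⟩, fun h => ?_⟩
  · obtain ⟨n, hn, rfl⟩ := hGJ.exists_mem_weights h
    exact hGJ.mem_weights_of_mem hA hd0 hd hn (by rintro rfl; exact hχ GJ.ofCoord_zero)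
  · obtain ⟨x, hx, hx0⟩ := Submodule.exists_mem_ne_zero_of_ne_bot h.2
    refine (Submodule.ne_bot_iff _).2 ⟨x, fun v => ?_, by simpa using hx0⟩
    exact congrArg Subtype.val (hx v)

theorem isFinGrading : IsFinGrading GJ D.gJ.incl := by
  refine ⟨Subtype.val_injective, ?_, fun χ _ => hGJ.finiteDimensional_wtSpaceι hA hd0 hd χ⟩
  rw [eq_top_iff, ← G.weight_decomp]
  refine iSup_le fun ψ => ?_
  by_cases hψ : wtSpaceι G.H.subtype ψ = ⊥
  · rw [hψ]; exact bot_le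
  obtain ⟨m, hm, rfl, -⟩ := G.exists_mem_weights_of_wtSpaceι_ne_bot hψ
  refine (hGJ.wt_le m).trans (le_iSup₂_of_le (GJ.ofCoord (res J m)) ?_ le_rfl)
  by_cases h0 : GJ.ofCoord (res J m) = 0
  · exact Or.inl h0
  · refine Or.inr ((hGJ.wtSpaceι_ne_bot_iff hA hd0 hd h0).1 fun h => hm ?_)
    exact eq_bot_iff.2 ((hGJ.wt_le m).trans h.le)

end CAdmissibleData.IsAssocKM

end KMG


open KMG

section Statement

attribute [local instance] Classical.propDecidable

variable {I : Type*} [Fintype I] [DecidableEq I] {A : Matrix I I ℤ}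
variable {g : Type*} [LieRing g] [LieAlgebra ℂ g]

theorem statement3
    (hGCM : IsGCM A) (hInd : Indecomposable A) (hSym : Symmetrizable A)
    (G : KacMoodyAlgebra A g) (J : Set I) (D : CAdmissibleData G J)
    (A' : Matrix {k : I // k ∉ J} {k : I // k ∉ J} ℤ)
    (GJ : KacMoodyAlgebra A' ↥D.gJ) (hGJ : D.IsAssocKM GJ) :
    IsFinGrading GJ D.gJ.incl ∧
    ∀ χ : Module.Dual ℂ ↥GJ.H, χ ≠ 0 →
      (wtSpaceι (D.gJ.incl.toLinearMap ∘ₗ GJ.H.subtype) χ ≠ ⊥ ↔ χ ∈ Delta GJ) := by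
  obtain ⟨d, hd0, hd⟩ := exists_pos_symmetrizer hGCM hInd hSym
  exact ⟨hGJ.isFinGrading hGCM hd0 hd, fun χ hχ => hGJ.wtSpaceι_ne_bot_iff hGCM hd0 hd hχ⟩

end Statement
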